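/- Asymptotic Harnack inequality: there exist constants C > 0, λ > 0 and ε₀ > 0, depending only on N, Λ, α, β, such that if ρ ≥ 0 and u is a bounded Borel measurable function on ℝ^N with u ≥ 0 in ℝ^N satisfying L_ε^+ u ≥ −ρ and L_ε^- u ≤ ρ in B_7 for some 0 < ε < ε₀, then sup_{B_1} u ≤ C (inf_{B_1} u + ρ + ε^{2λ} sup_{B_3} u). -/

import Mathlib

open MeasureTheory Metric

/-- The second-order difference `δu(x,y) = u(x+y) + u(x−y) − 2u(x)`. -/
noncomputable def ddiff {N : ℕ} (u : EuclideanSpace ℝ (Fin N) → ℝ)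
    (x y : EuclideanSpace ℝ (Fin N)) : ℝ :=
  u (x + y) + u (x - y) - 2 * u x

/-- The maximal Pucci-type operator
`L_ε^+ u(x) = (1/(2ε²))(α·sup_{z ∈ B_Λ} δu(x,εz) + β·⨍_{B_1} δu(x,εy) dy)`. -/
noncomputable def Lplus {N : ℕ} (Λ α β ε : ℝ) (u : EuclideanSpace ℝ (Fin N) → ℝ)
    (x : EuclideanSpace ℝ (Fin N)) : ℝ :=
  (1 / (2 * ε ^ 2)) *
    (α * sSup ((fun z => ddiff u x (ε • z)) '' ball (0 : EuclideanSpace ℝ (Fin N)) Λ)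
      + β * ⨍ y in ball (0 : EuclideanSpace ℝ (Fin N)) 1, ddiff u x (ε • y))

/-- The minimal Pucci-type operator
`L_ε^- u(x) = (1/(2ε²))(α·inf_{z ∈ B_Λ} δu(x,εz) + β·⨍_{B_1} δu(x,εy) dy)`. -/
noncomputable def Lminus {N : ℕ} (Λ α β ε : ℝ) (u : EuclideanSpace ℝ (Fin N) → ℝ)
    (x : EuclideanSpace ℝ (Fin N)) : ℝ :=
  (1 / (2 * ε ^ 2)) *
    (α * sInf ((fun z => ddiff u x (ε • z)) '' ball (0 : EuclideanSpace ℝ (Fin N)) Λ)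
      + β * ⨍ y in ball (0 : EuclideanSpace ℝ (Fin N)) 1, ddiff u x (ε • y))

namespace AsymptoticHarnack

variable {N : ℕ}

local notation "𝔼" => EuclideanSpace ℝ (Fin N)

/-! ### Volumes and averages -/

lemma volume_ball {r : ℝ} (hr : 0 < r) (x : 𝔼) :
    volume.real (ball x r) = r ^ N * volume.real (ball (0 : 𝔼) 1) := by
  simp [measureReal_def, Measure.addHaar_ball_of_pos volume x hr, hr.le]

lemma volume_unitBall_pos : 0 < volume.real (ball (0 : 𝔼) 1) :=
  ENNReal.toReal_pos (measure_ball_pos volume _ one_pos).ne' measure_ball_lt_top.ne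

lemma volume_ne_top {t : Set 𝔼} {x : 𝔼} {r : ℝ} (ht : t ⊆ ball x r) : volume t ≠ ⊤ :=
  ((measure_mono ht).trans_lt measure_ball_lt_top).ne

lemma volume_mono {s t : Set 𝔼} {x : 𝔼} {r : ℝ} (hst : s ⊆ t) (ht : t ⊆ ball x r) :
    volume.real s ≤ volume.real t :=
  measureReal_mono hst (volume_ne_top ht)

lemma average_le_average_add {f g : 𝔼 → ℝ} {k : ℝ} (hf : IntegrableOn f (ball 0 1))
    (hg : IntegrableOn g (ball 0 1)) (h : ∀ y ∈ ball (0 : 𝔼) 1, f y ≤ g y + k) :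
    ⨍ y in ball (0 : 𝔼) 1, f y ≤ (⨍ y in ball (0 : 𝔼) 1, g y) + k := by
  have hv := volume_unitBall_pos (N := N)
  have hk : IntegrableOn (fun _ : 𝔼 => k) (ball 0 1) :=
    integrableOn_const measure_ball_lt_top.ne
  have h1 := setIntegral_mono_on hf (hg.add hk) measurableSet_ball h
  simp only [Pi.add_apply] at h1
  rw [integral_add hg hk, setIntegral_const, smul_eq_mul] at h1
  rw [setAverage_eq, setAverage_eq, smul_eq_mul, smul_eq_mul]
  calc _ ≤ (volume.real (ball (0 : 𝔼) 1))⁻¹ * (_ + _) :=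
        mul_le_mul_of_nonneg_left h1 (inv_nonneg.2 hv.le)
    _ = _ := by field_simp

lemma volume_superlevel_le_average {g : 𝔼 → ℝ} (hg : IntegrableOn g (ball 0 1))
    (h0 : ∀ y ∈ ball (0 : 𝔼) 1, 0 ≤ g y) (t : ℝ) :
    t * volume.real ({y | t ≤ g y} ∩ ball 0 1) ≤
      (⨍ y in ball (0 : 𝔼) 1, g y) * volume.real (ball (0 : 𝔼) 1) := by
  have hv := volume_unitBall_pos (N := N)
  have h1 := mul_meas_ge_le_integral_of_nonneg
    ((ae_restrict_iff' measurableSet_ball).2 (Filter.Eventually.of_forall h0)) hg t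
  rw [measureReal_restrict_apply' measurableSet_ball] at h1
  rw [setAverage_eq, smul_eq_mul]
  calc _ ≤ _ := h1
    _ = _ := by field_simp

lemma volume_rescale {x : 𝔼} {ε : ℝ} (hε : 0 < ε) (S : Set 𝔼) :
    volume.real S = ε ^ N * volume.real ((fun y => x + ε • y) ⁻¹' S) := by
  have h1 : (fun y => x + ε • y) ⁻¹' S = (fun y => ε • y) ⁻¹' ((fun y => x + y) ⁻¹' S) := rfl
  have hε' : (0 : ℝ) < ε ^ N := by positivity
  rw [h1, measureReal_def, measureReal_def, Measure.addHaar_preimage_smul volume hε.ne',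
    measure_preimage_add, ENNReal.toReal_mul, finrank_euclideanSpace_fin,
    ENNReal.toReal_ofReal (abs_nonneg _), abs_of_pos (inv_pos.2 hε')]
  field_simp

lemma preimage_ball_rescale {x₀ x : 𝔼} {r s : ℝ} (hr : 0 < r) :
    (fun y => x₀ + r • y) ⁻¹' ball (x₀ + r • x) (r * s) = ball x s := by
  ext y
  have h : x₀ + r • y - (x₀ + r • x) = r • (y - x) := by rw [smul_sub]; abel
  simp only [Set.mem_preimage, mem_ball, dist_eq_norm, h, norm_smul, Real.norm_eq_abs,
    abs_of_pos hr]
  exact mul_lt_mul_iff_right₀ hr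

lemma integrableOn_of_abs_le {g : 𝔼 → ℝ} {K : ℝ} (hg : Measurable g)
    (h : ∀ y ∈ ball (0 : 𝔼) 1, |g y| ≤ K) : IntegrableOn g (ball 0 1) :=
  Measure.integrableOn_of_bounded (M := K) measure_ball_lt_top.ne hg.aestronglyMeasurable
    ((ae_restrict_iff' measurableSet_ball).2 (Filter.Eventually.of_forall h))

lemma measurable_ddiff {u : 𝔼 → ℝ} (hu : Measurable u) (x : 𝔼) (ε : ℝ) :
    Measurable fun y => ddiff u x (ε • y) := by
  unfold ddiff
  fun_prop

lemma integrableOn_ddiff {u : 𝔼 → ℝ} {K ε : ℝ} {x : 𝔼} (hu : Measurable u) (hε : 0 < ε)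
    (h : ∀ y ∈ ball x ε, |u y| ≤ K) :
    IntegrableOn (fun y => ddiff u x (ε • y)) (ball 0 1) := by
  refine integrableOn_of_abs_le (K := K + K + 2 * K) (measurable_ddiff hu x ε) fun y hy => ?_
  have hy' : ‖ε • y‖ < ε := by
    rw [norm_smul, Real.norm_eq_abs, abs_of_pos hε]
    nlinarith [mem_ball_zero_iff.1 hy]
  have h1 := abs_le.1 (h (x + ε • y) (by simpa [mem_ball, dist_eq_norm] using hy'))
  have h2 := abs_le.1 (h (x - ε • y) (by simpa [mem_ball, dist_eq_norm] using hy'))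
  have h3 := abs_le.1 (h x (mem_ball_self hε))
  rw [ddiff, abs_le]
  constructor <;> linarith

/-- A nonnegative function whose averaged second difference at `x` is small is small on most of
the ball `B_ε(x)`. -/
lemma volume_superlevel_le_ddiff {w : 𝔼 → ℝ} {K ε : ℝ} {x : 𝔼} (hw : Measurable w)
    (hε : 0 < ε) (hK : ∀ y ∈ ball x ε, |w y| ≤ K) (h0 : ∀ y ∈ ball x ε, 0 ≤ w y) (t : ℝ) :
    t * volume.real (ball x ε ∩ {y | t ≤ w y}) ≤
      ((⨍ y in ball (0 : 𝔼) 1, ddiff w x (ε • y)) + 2 * w x) * volume.real (ball x ε) := by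
  have hmem : ∀ y ∈ ball (0 : 𝔼) 1, x + ε • y ∈ ball x ε ∧ x - ε • y ∈ ball x ε := by
    intro y hy
    have hy' : ‖ε • y‖ < ε := by
      rw [norm_smul, Real.norm_eq_abs, abs_of_pos hε]
      nlinarith [mem_ball_zero_iff.1 hy]
    constructor <;> simpa [mem_ball, dist_eq_norm] using hy'
  have hg : IntegrableOn (fun y => w (x + ε • y)) (ball 0 1) :=
    integrableOn_of_abs_le (by fun_prop) fun y hy => hK _ (hmem y hy).1
  have h1 := volume_superlevel_le_average hg (fun y hy => h0 _ (hmem y hy).1) t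
  have h2 : (⨍ y in ball (0 : 𝔼) 1, w (x + ε • y)) ≤
      (⨍ y in ball (0 : 𝔼) 1, ddiff w x (ε • y)) + 2 * w x := by
    refine average_le_average_add hg (integrableOn_ddiff hw hε hK) fun y hy => ?_
    have := h0 _ (hmem y hy).2
    rw [ddiff]; linarith
  have h3 : (fun y => x + ε • y) ⁻¹' (ball x ε ∩ {y | t ≤ w y}) =
      {y | t ≤ w (x + ε • y)} ∩ ball 0 1 := by
    have := preimage_ball_rescale (x₀ := x) (x := 0) (s := 1) hε
    rw [smul_zero, add_zero, mul_one] at this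
    rw [Set.preimage_inter, this, Set.inter_comm]
    rfl
  rw [volume_rescale (x := x) hε (ball x ε ∩ {y | t ≤ w y}), h3, volume_ball hε]
  have hv := volume_unitBall_pos (N := N)
  calc _ = ε ^ N * (t * volume.real ({y | t ≤ w (x + ε • y)} ∩ ball 0 1)) := by ring
    _ ≤ ε ^ N * (((⨍ y in ball (0 : 𝔼) 1, ddiff w x (ε • y)) + 2 * w x) *
        volume.real (ball (0 : 𝔼) 1)) :=
      mul_le_mul_of_nonneg_left (h1.trans (mul_le_mul_of_nonneg_right h2 hv.le)) (by positivity)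
    _ = _ := by ring

/-! ### A Vitali covering estimate -/

open scoped ENNReal in
/-- If every `{y ∈ Z : |c y - c s| < 6 r s}` has measure at most `C` times that of the part of `W`
in the ball `B_{r s}(c s)`, then `|Z| ≤ C |W|`. -/
lemma volume_le_of_forall_ball {Z W : Set 𝔼} {c : 𝔼 → 𝔼} {r : 𝔼 → ℝ} {R : ℝ} {C : ℝ≥0∞}
    (hW : MeasurableSet W) (hr : ∀ s ∈ Z, 0 < r s ∧ r s ≤ R)
    (h : ∀ s ∈ Z, volume {y ∈ Z | dist (c y) (c s) < 6 * r s} ≤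
      C * volume (W ∩ ball (c s) (r s))) :
    volume Z ≤ C * volume W := by
  obtain ⟨S, hSZ, hdisj, hcov⟩ := Vitali.exists_disjoint_subfamily_covering_enlargement_closedBall
    Z c r R (fun a ha => (hr a ha).2) 5 (by norm_num)
  have hcount : S.Countable := by
    refine hdisj.countable_of_nonempty_interior fun s hs => ?_
    exact ⟨c s, ball_subset_interior_closedBall (mem_ball_self (hr s (hSZ hs)).1)⟩
  have hsub : Z ⊆ ⋃ s ∈ S, {y ∈ Z | dist (c y) (c s) < 6 * r s} := by
    intro y hy
    obtain ⟨s, hs, hys⟩ := hcov y hy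
    have h1 := hys (mem_closedBall_self (hr y hy).1.le)
    have h2 := (hr s (hSZ hs)).1
    exact Set.mem_biUnion hs ⟨hy, by rw [mem_closedBall] at h1; linarith⟩
  calc volume Z ≤ volume (⋃ s ∈ S, {y ∈ Z | dist (c y) (c s) < 6 * r s}) := measure_mono hsub
    _ ≤ ∑' s : S, volume {y ∈ Z | dist (c y) (c s) < 6 * r s} := measure_biUnion_le _ hcount _
    _ ≤ ∑' s : S, C * volume (W ∩ ball (c s) (r s)) :=
      ENNReal.tsum_le_tsum fun s => h s (hSZ s.2)
    _ = C * ∑' s : S, volume (W ∩ ball (c s) (r s)) := ENNReal.tsum_mul_left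
    _ = C * volume (⋃ s ∈ S, W ∩ ball (c s) (r s)) := by
      rw [measure_biUnion hcount _ fun s _ => hW.inter measurableSet_ball]
      intro a ha b hb hab
      exact (hdisj ha hb hab).mono (Set.inter_subset_right.trans ball_subset_closedBall)
        (Set.inter_subset_right.trans ball_subset_closedBall)
    _ ≤ C * volume W := by
      gcongr
      exact Set.iUnion₂_subset fun _ _ => Set.inter_subset_left

/-- Real-valued form of `volume_le_of_forall_ball`. -/
lemma volume_real_le_of_forall_ball {Z W : Set 𝔼} {c : 𝔼 → 𝔼} {r : 𝔼 → ℝ} {R C L : ℝ}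
    (hC : 0 ≤ C) (hW : MeasurableSet W) (hZb : Z ⊆ ball 0 L) (hWb : W ⊆ ball 0 L)
    (hr : ∀ s ∈ Z, 0 < r s ∧ r s ≤ R)
    (h : ∀ s ∈ Z, volume.real {y ∈ Z | dist (c y) (c s) < 6 * r s} ≤
      C * volume.real (W ∩ ball (c s) (r s))) :
    volume.real Z ≤ C * volume.real W := by
  have key := volume_le_of_forall_ball (c := c) (r := r) (R := R) (C := ENNReal.ofReal C) hW hr
    fun s hs => by
      have := h s hs
      have f1 : volume {y ∈ Z | dist (c y) (c s) < 6 * r s} ≠ ⊤ := volume_ne_top fun y hy => hZb hy.1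
      have f2 : volume (W ∩ ball (c s) (r s)) ≠ ⊤ := volume_ne_top fun y hy => hWb hy.1
      rw [← ENNReal.ofReal_toReal f1, ← ENNReal.ofReal_toReal f2, ← ENNReal.ofReal_mul hC]
      exact ENNReal.ofReal_le_ofReal this
  have := ENNReal.toReal_mono (ENNReal.mul_ne_top ENNReal.ofReal_ne_top (volume_ne_top hWb)) key
  rwa [ENNReal.toReal_mul, ENNReal.toReal_ofReal hC] at this

lemma volume_le_add {s A B : Set 𝔼} {x y : 𝔼} {r r' : ℝ} (h : s ⊆ A ∪ B) (hA : A ⊆ ball x r)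
    (hB : B ⊆ ball y r') : volume.real s ≤ volume.real A + volume.real B :=
  (measureReal_mono h (measure_union_lt_top (volume_ne_top hA).lt_top
    (volume_ne_top hB).lt_top).ne).trans (measureReal_union_le A B)

/-! ### Supersolutions -/

/-- `L_ε^- u(x) ≤ ρ`, phrased through lower bounds of the second differences. -/
def SuperAt (Λ α β ε ρ : ℝ) (u : 𝔼 → ℝ) (x : 𝔼) : Prop :=
  ∀ m : ℝ, (∀ z ∈ ball (0 : 𝔼) Λ, m ≤ ddiff u x (ε • z)) →
    α * m + β * ⨍ y in ball (0 : 𝔼) 1, ddiff u x (ε • y) ≤ 2 * ε ^ 2 * ρ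

/-- A nonnegative bounded measurable function with `L_ε^- u ≤ ρ` in `B_R(x₀)`. -/
structure IsSupersol (Λ α β ε ρ : ℝ) (u : 𝔼 → ℝ) (x₀ : 𝔼) (R : ℝ) : Prop where
  measurable : Measurable u
  bounded : ∃ K, ∀ x, |u x| ≤ K
  nonneg : ∀ x, 0 ≤ u x
  superAt : ∀ x ∈ ball x₀ R, SuperAt Λ α β ε ρ u x

variable {Λ α β ε ρ : ℝ} {R : ℝ} {u : EuclideanSpace ℝ (Fin N) → ℝ}
  {x₀ x : EuclideanSpace ℝ (Fin N)}

lemma SuperAt.mono {ρ' : ℝ} (h : SuperAt Λ α β ε ρ u x) (hρ : ρ ≤ ρ') :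
    SuperAt Λ α β ε ρ' u x := by
  intro m hm
  have := h m hm
  have h2 : 2 * ε ^ 2 * ρ ≤ 2 * ε ^ 2 * ρ' := mul_le_mul_of_nonneg_left hρ (by positivity)
  linarith

lemma IsSupersol.mono {ρ' R' : ℝ} {x₁ : 𝔼} (h : IsSupersol Λ α β ε ρ u x₀ R) (hρ : ρ ≤ ρ')
    (hR : ball x₁ R' ⊆ ball x₀ R) : IsSupersol Λ α β ε ρ' u x₁ R' :=
  ⟨h.measurable, h.bounded, h.nonneg, fun x hx => (h.superAt x (hR hx)).mono hρ⟩

lemma SuperAt.congr {v : 𝔼 → ℝ} (h : SuperAt Λ α β ε ρ u x) (hΛ : 1 ≤ Λ) (hε : 0 < ε)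
    (huv : ∀ y ∈ ball x (Λ * ε), u y = v y) : SuperAt Λ α β ε ρ v x := by
  have hd : ∀ z ∈ ball (0 : 𝔼) Λ, ddiff u x (ε • z) = ddiff v x (ε • z) := by
    intro z hz
    have hz' : ‖ε • z‖ < Λ * ε := by
      rw [norm_smul, Real.norm_eq_abs, abs_of_pos hε]
      nlinarith [mem_ball_zero_iff.1 hz]
    rw [ddiff, ddiff, huv (x + ε • z) (by simpa [mem_ball, dist_eq_norm] using hz'),
      huv (x - ε • z) (by simpa [mem_ball, dist_eq_norm] using hz'),
      huv x (mem_ball_self (by positivity))]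
  intro m hm
  have h1 : ⨍ y in ball (0 : 𝔼) 1, ddiff v x (ε • y) = ⨍ y in ball (0 : 𝔼) 1, ddiff u x (ε • y) :=
    setAverage_congr_fun measurableSet_ball
      (Filter.Eventually.of_forall fun y hy => (hd y (ball_subset_ball hΛ hy)).symm)
  rw [h1]
  exact h m fun z hz => (hm z hz).trans_eq (hd z hz).symm

lemma SuperAt.rescale {r t : ℝ} (h : SuperAt Λ α β ε ρ u (x₀ + r • x)) (hr : 0 < r) (ht : 0 < t)
    (b : ℝ) :
    SuperAt Λ α β (ε / r) (t * ρ * r ^ 2) (fun y => t * u (x₀ + r • y) + b) x := by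
  have hd : ∀ z : 𝔼, ddiff (fun y => t * u (x₀ + r • y) + b) x ((ε / r) • z) =
      t * ddiff u (x₀ + r • x) (ε • z) := by
    intro z
    have hs : r • (ε / r) • z = ε • z := by
      rw [smul_smul, mul_div_cancel₀ _ hr.ne']
    simp only [ddiff, smul_add, smul_sub, hs, ← add_assoc, ← add_sub_assoc]
    ring
  intro m hm
  have h1 := h (m / t) fun z hz => by
    rw [div_le_iff₀' ht, ← hd]; exact hm z hz
  simp only [hd]
  have hav : ⨍ y in ball (0 : 𝔼) 1, t * ddiff u (x₀ + r • x) (ε • y) =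
      t * ⨍ y in ball (0 : 𝔼) 1, ddiff u (x₀ + r • x) (ε • y) := by
    rw [setAverage_eq, setAverage_eq, integral_const_mul, smul_eq_mul, smul_eq_mul, mul_left_comm]
  rw [hav]
  calc _ = t * (α * (m / t) + β * ⨍ y in ball (0 : 𝔼) 1, ddiff u (x₀ + r • x) (ε • y)) := by
        field_simp
    _ ≤ t * (2 * ε ^ 2 * ρ) := by gcongr
    _ = _ := by field_simp

lemma IsSupersol.rescale {r t : ℝ} (h : IsSupersol Λ α β ε ρ u x₀ (r * R)) (hr : 0 < r)
    (ht : 0 < t) :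
    IsSupersol Λ α β (ε / r) (t * ρ * r ^ 2) (fun y => t * u (x₀ + r • y)) 0 R := by
  have hu := h.measurable
  refine ⟨by fun_prop, ?_, fun x => mul_nonneg ht.le (h.nonneg _), fun x hx => ?_⟩
  · obtain ⟨K, hK⟩ := h.bounded
    refine ⟨t * K, fun x => ?_⟩
    rw [abs_mul, abs_of_pos ht]
    exact mul_le_mul_of_nonneg_left (hK _) ht.le
  · have hx' : x₀ + r • x ∈ ball x₀ (r * R) := by
      rw [mem_ball, dist_eq_norm, add_sub_cancel_left, norm_smul, Real.norm_eq_abs, abs_of_pos hr]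
      exact mul_lt_mul_of_pos_left (mem_ball_zero_iff.1 hx) hr
    simpa using (h.superAt _ hx').rescale hr ht 0

/-- At a point of `B_R(x₀)` a supersolution controls its superlevel sets at scale `ε`. -/
lemma IsSupersol.volume_superlevel_le (h : IsSupersol Λ α β ε ρ u x₀ R) (hα : 0 ≤ α) (hβ : 0 < β)
    (hαβ : α + β = 1) (hε : 0 < ε) (hx : x ∈ ball x₀ R) (t : ℝ) :
    β / 2 * (t * volume.real (ball x ε ∩ {y | t ≤ u y})) ≤
      (ε ^ 2 * ρ + u x) * volume.real (ball x ε) := by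
  obtain ⟨K, hK⟩ := h.bounded
  have h1 := h.superAt x hx (-2 * u x) fun z _ => by
    rw [ddiff]; linarith [h.nonneg (x + ε • z), h.nonneg (x - ε • z)]
  have h2 := volume_superlevel_le_ddiff h.measurable hε (fun y _ => hK y) (fun y _ => h.nonneg y) t
    (x := x)
  calc _ ≤ β / 2 * (((⨍ y in ball (0 : 𝔼) 1, ddiff u x (ε • y)) + 2 * u x) *
        volume.real (ball x ε)) := by gcongr
    _ = ((β * (⨍ y in ball (0 : 𝔼) 1, ddiff u x (ε • y)) + 2 * β * u x) / 2) *
        volume.real (ball x ε) := by ring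
    _ ≤ _ := by
      refine mul_le_mul_of_nonneg_right ?_ measureReal_nonneg
      have : α = 1 - β := by linarith
      subst this
      linarith

/-! ### The measure estimate by sliding paraboloids -/

/-- A paraboloid with vertex `y` near the origin touches `u` from below, up to `ε²`. -/
lemma exists_touching_point {y : 𝔼} (hu : ∀ x, 0 ≤ u x) (h1 : u 0 ≤ 1) (hε : 0 < ε)
    (hε1 : ε ≤ 1 / 4) (hy : y ∈ ball (0 : 𝔼) (1 / 4)) :
    ∃ (x : 𝔼) (k : ℝ), x ∈ ball (0 : 𝔼) (3 / 4) ∧ k ≤ 2 ∧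
      (∀ z : 𝔼, k ≤ u z + 16 * ‖z - y‖ ^ 2) ∧ u x + 16 * ‖x - y‖ ^ 2 ≤ k + ε ^ 2 := by
  have hbdd : BddBelow (Set.range fun z : 𝔼 => u z + 16 * ‖z - y‖ ^ 2) :=
    ⟨0, by rintro _ ⟨z, rfl⟩; have := hu z; positivity⟩
  rw [mem_ball_zero_iff] at hy
  have hk : ⨅ z : 𝔼, (u z + 16 * ‖z - y‖ ^ 2) ≤ 2 := by
    refine (ciInf_le hbdd 0).trans ?_
    rw [zero_sub, norm_neg]
    nlinarith [norm_nonneg y]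
  obtain ⟨x, hx⟩ := exists_lt_of_ciInf_lt
    (lt_add_of_pos_right (⨅ z : 𝔼, (u z + 16 * ‖z - y‖ ^ 2)) (show 0 < ε ^ 2 by positivity))
  refine ⟨x, _, ?_, hk, fun z => ciInf_le hbdd z, hx.le⟩
  have h2 : ‖x - y‖ < 1 / 2 := by
    have := hu x
    nlinarith [norm_nonneg (x - y)]
  rw [mem_ball_zero_iff]
  calc ‖x‖ = ‖x - y + y‖ := by rw [sub_add_cancel]
    _ ≤ ‖x - y‖ + ‖y‖ := norm_add_le _ _
    _ < _ := by linarith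

/-- Near a touching point, `u` stays within `O(ε²)` of the paraboloid on most of `B_ε(x)`. -/
lemma IsSupersol.volume_touching_le {y : 𝔼} {k : ℝ} (h : IsSupersol Λ α β ε 1 u x₀ R)
    (hβ : 0 < β) (hαβ : α + β = 1) (hε : 0 < ε) (hx : x ∈ ball x₀ R)
    (hk : ∀ z : 𝔼, k ≤ u z + 16 * ‖z - y‖ ^ 2) (hxk : u x + 16 * ‖x - y‖ ^ 2 ≤ k + ε ^ 2) (t : ℝ) :
    t * volume.real (ball x ε ∩ {z | t ≤ u z + 16 * ‖z - y‖ ^ 2 - k}) ≤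
      ((4 + 32 * Λ ^ 2) / β + 34) * ε ^ 2 * volume.real (ball x ε) := by
  obtain ⟨K, hK⟩ := h.bounded
  have hu := h.measurable
  have hpar : ∀ z : 𝔼, ‖x + z - y‖ ^ 2 + ‖x - z - y‖ ^ 2 = 2 * ‖x - y‖ ^ 2 + 2 * ‖z‖ ^ 2 := by
    intro z
    have := parallelogram_law_with_norm ℝ (x - y) z
    rw [show x + z - y = x - y + z by abel, show x - z - y = x - y - z by abel]
    nlinarith
  have hd : ∀ z : 𝔼, ddiff (fun z : 𝔼 => u z + 16 * ‖z - y‖ ^ 2 - k) x z =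
      ddiff u x z + 32 * ‖z‖ ^ 2 := by
    intro z
    have := hpar z
    simp only [ddiff]
    linarith
  have hnorm : ∀ z : 𝔼, ∀ s, z ∈ ball (0 : 𝔼) s → ‖ε • z‖ ^ 2 ≤ s ^ 2 * ε ^ 2 := by
    intro z s hz
    rw [mem_ball_zero_iff] at hz
    rw [norm_smul, mul_pow, Real.norm_eq_abs, sq_abs, mul_comm]
    gcongr
  have h1 := h.superAt x hx (-(2 + 32 * Λ ^ 2) * ε ^ 2) fun z hz => by
    have h2 := hd (ε • z)
    have h3 := hnorm z Λ hz
    have h4 := hk (x + ε • z)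
    have h5 := hk (x - ε • z)
    rw [ddiff] at h2
    nlinarith
  have hK' : ∀ z ∈ ball x ε, |u z + 16 * ‖z - y‖ ^ 2 - k| ≤ K + 16 * (ε + ‖x - y‖) ^ 2 + |k| := by
    intro z hz
    rw [mem_ball, dist_eq_norm] at hz
    have h2 : ‖z - y‖ ≤ ε + ‖x - y‖ := by
      calc ‖z - y‖ = ‖z - x + (x - y)‖ := by rw [sub_add_sub_cancel]
        _ ≤ ‖z - x‖ + ‖x - y‖ := norm_add_le _ _
        _ ≤ _ := by linarith
    have h3 : ‖z - y‖ ^ 2 ≤ (ε + ‖x - y‖) ^ 2 := by gcongr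
    have h4 := abs_le.1 (hK z)
    have h5 := neg_abs_le k
    have h6 := le_abs_self k
    rw [abs_le]
    constructor <;> nlinarith [sq_nonneg ‖z - y‖]
  have hw : Measurable fun z : 𝔼 => u z + 16 * ‖z - y‖ ^ 2 - k := by fun_prop
  refine (volume_superlevel_le_ddiff hw hε hK' (fun z _ => sub_nonneg.2 (hk z)) t).trans ?_
  refine mul_le_mul_of_nonneg_right ?_ measureReal_nonneg
  have h2 : (⨍ z in ball (0 : 𝔼) 1, ddiff (fun z : 𝔼 => u z + 16 * ‖z - y‖ ^ 2 - k) x (ε • z)) ≤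
      (⨍ z in ball (0 : 𝔼) 1, ddiff u x (ε • z)) + 32 * ε ^ 2 := by
    refine average_le_average_add (integrableOn_ddiff hw hε hK')
      (integrableOn_ddiff hu hε fun z _ => hK z) fun z hz => ?_
    have := hnorm z 1 hz
    rw [hd]; linarith
  have h3 : (⨍ z in ball (0 : 𝔼) 1, ddiff u x (ε • z)) ≤ (4 + 32 * Λ ^ 2) / β * ε ^ 2 := by
    rw [div_mul_eq_mul_div, le_div_iff₀ hβ]
    have : α ≤ 1 := by linarith
    nlinarith [mul_nonneg (show 0 ≤ 1 - α by linarith)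
      (show 0 ≤ (2 + 32 * Λ ^ 2) * ε ^ 2 by positivity)]
  linarith

lemma exists_mem_ball_of_volume_le {p x x' : 𝔼} {w w' : 𝔼 → ℝ} {t : ℝ} (hε : 0 < ε)
    (hp : ball p (ε / 8) ⊆ ball x ε) (hp' : ball p (ε / 8) ⊆ ball x' ε)
    (hw : volume.real (ball x ε ∩ {z | t ≤ w z}) ≤ 1 / (4 * 32 ^ N) * volume.real (ball x ε))
    (hw' : volume.real (ball x' ε ∩ {z | t ≤ w' z}) ≤ 1 / (4 * 32 ^ N) * volume.real (ball x' ε)) :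
    ∃ z ∈ ball p (ε / 8), w z < t ∧ w' z < t := by
  by_contra! hcon
  have hsub : ball p (ε / 8) ⊆ (ball x ε ∩ {z | t ≤ w z}) ∪ (ball x' ε ∩ {z | t ≤ w' z}) := by
    intro z hz
    rcases lt_or_ge (w z) t with h | h
    · exact Or.inr ⟨hp' hz, hcon z hz h⟩
    · exact Or.inl ⟨hp hz, h⟩
  have h1 := volume_le_add hsub Set.inter_subset_left Set.inter_subset_left
  rw [volume_ball hε] at hw hw'
  rw [volume_ball (by positivity)] at h1
  have hv := volume_unitBall_pos (N := N)
  have hle : (1 : ℝ) / (4 * 32 ^ N) ≤ 1 / (4 * 8 ^ N) := by gcongr; norm_num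
  have h2 : 1 / (4 * 32 ^ N) * (ε ^ N * volume.real (ball (0 : 𝔼) 1)) ≤
      1 / (4 * 8 ^ N) * (ε ^ N * volume.real (ball (0 : 𝔼) 1)) := by gcongr
  have h3 : (ε / 8) ^ N * volume.real (ball (0 : 𝔼) 1) =
      4 * (1 / (4 * 8 ^ N) * (ε ^ N * volume.real (ball (0 : 𝔼) 1))) := by
    rw [div_pow]; field_simp
  have h4 : 0 < 1 / (4 * 8 ^ N) * (ε ^ N * volume.real (ball (0 : 𝔼) 1)) := by positivity
  linarith

/-- Paraboloids touching at nearby points have nearby vertices. -/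
lemma dist_vertex_le {x x' y y' : 𝔼} {k k' C : ℝ} (hε : 0 < ε) (hxx' : dist x x' ≤ ε / 4)
    (hk : ∀ z, k ≤ u z + 16 * ‖z - y‖ ^ 2) (hk' : ∀ z, k' ≤ u z + 16 * ‖z - y'‖ ^ 2)
    (hw : volume.real (ball x ε ∩ {z | C * ε ^ 2 ≤ u z + 16 * ‖z - y‖ ^ 2 - k}) ≤
      1 / (4 * 32 ^ N) * volume.real (ball x ε))
    (hw' : volume.real (ball x' ε ∩ {z | C * ε ^ 2 ≤ u z + 16 * ‖z - y'‖ ^ 2 - k'}) ≤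
      1 / (4 * 32 ^ N) * volume.real (ball x' ε)) :
    ‖y - y'‖ ≤ C * ε := by
  rcases eq_or_ne y y' with rfl | hne
  · obtain ⟨z, -, hz, -⟩ := exists_mem_ball_of_volume_le hε
      (ball_subset_ball (by linarith)) (ball_subset_ball (by linarith)) hw hw
    have h1 := hk z
    rw [sub_self, norm_zero]
    nlinarith
  have hd : 0 < ‖y - y'‖ := norm_pos_iff.2 (sub_ne_zero.2 hne)
  set e : 𝔼 := ‖y - y'‖⁻¹ • (y - y') with he
  have he1 : ‖e‖ = 1 := by
    rw [he, norm_smul, norm_inv, norm_norm, inv_mul_cancel₀ hd.ne']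
  have hye : y - y' = ‖y - y'‖ • e := by
    rw [he, smul_smul, mul_inv_cancel₀ hd.ne', one_smul]
  have hball : ∀ s : ℝ, |s| = ε / 2 → ball (x + s • e) (ε / 8) ⊆ ball x ε ∧
      ball (x + s • e) (ε / 8) ⊆ ball x' ε := by
    intro s hs
    have h1 : dist (x + s • e) x = ε / 2 := by
      rw [dist_eq_norm, add_sub_cancel_left, norm_smul, he1, mul_one, Real.norm_eq_abs, hs]
    have h2 := dist_triangle (x + s • e) x x'
    exact ⟨ball_subset_ball' (by linarith), ball_subset_ball' (by linarith)⟩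
  have hb1 := hball (ε / 2) (abs_of_pos (by positivity))
  have hb2 := hball (-(ε / 2)) (by rw [abs_neg, abs_of_pos (by positivity)])
  obtain ⟨z, hz, hz1, hz2⟩ := exists_mem_ball_of_volume_le hε hb1.1 hb1.2 hw hw'
  obtain ⟨z', hz', hz1', hz2'⟩ := exists_mem_ball_of_volume_le hε hb2.1 hb2.2 hw hw'
  have hin : ∀ p : 𝔼, ‖p - y‖ ^ 2 - ‖p - y'‖ ^ 2 =
      ‖y‖ ^ 2 - ‖y'‖ ^ 2 - 2 * inner ℝ p (y - y') := by
    intro p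
    rw [norm_sub_sq_real, norm_sub_sq_real, inner_sub_right]; ring
  have hdiff : 32 * inner ℝ (z - z') (y - y') ≤ 2 * C * ε ^ 2 := by
    have i1 := hin z
    have i2 := hin z'
    have := hk z
    have := hk' z
    have := hk z'
    have := hk' z'
    rw [inner_sub_left]
    linarith
  have hlow : 3 / 4 * ε ≤ inner ℝ (z - z') e := by
    have h1 : ∀ (s : ℝ) (q : 𝔼), q ∈ ball (x + s • e) (ε / 8) →
        |inner ℝ (q - x) e - s| ≤ ε / 8 := by
      intro s q hq
      have h2 : inner ℝ (q - x) e - s = inner ℝ (q - (x + s • e)) e := by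
        rw [← sub_sub, inner_sub_left (q - x), real_inner_smul_left, real_inner_self_eq_norm_sq,
          he1]
        ring
      rw [h2]
      refine (abs_real_inner_le_norm _ _).trans ?_
      rw [he1, mul_one, ← dist_eq_norm]
      exact (mem_ball.1 hq).le
    have h2 := (abs_le.1 (h1 _ z hz)).1
    have h3 := (abs_le.1 (h1 _ z' hz')).2
    rw [← sub_sub_sub_cancel_right z z' x, inner_sub_left]
    linarith
  have hfin : inner ℝ (z - z') (y - y') = ‖y - y'‖ * inner ℝ (z - z') e := by
    conv_lhs => rw [hye]
    rw [real_inner_smul_right]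
  rw [hfin] at hdiff
  have h5 : 32 * (‖y - y'‖ * (3 / 4 * ε)) ≤ 2 * C * ε ^ 2 := by
    refine le_trans ?_ hdiff
    gcongr
  have h6 : 12 * ‖y - y'‖ ≤ C * ε := by nlinarith
  linarith

/-- A supersolution with `u(0) ≤ 1` is bounded on a fixed proportion of the unit ball. -/
lemma exists_volume_sublevel_ge (Λ : ℝ) {α β : ℝ} (hβ : 0 < β)
    (hαβ : α + β = 1) :
    ∃ M c : ℝ, 1 ≤ M ∧ 0 < c ∧ ∀ ε : ℝ, 0 < ε → ε ≤ 1 / 4 → ∀ u : 𝔼 → ℝ,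
      IsSupersol Λ α β ε 1 u 0 1 → u 0 ≤ 1 →
        c * volume.real (ball (0 : 𝔼) 1) ≤ volume.real (ball (0 : 𝔼) 1 ∩ {x | u x ≤ M}) := by
  obtain ⟨C₁, hC₁⟩ : ∃ C₁ : ℝ, C₁ = (4 + 32 * Λ ^ 2) / β + 34 := ⟨_, rfl⟩
  have hC₁0 : 0 < C₁ := by rw [hC₁]; positivity
  obtain ⟨C, hC⟩ : ∃ C : ℝ, C = 4 * 32 ^ N * C₁ := ⟨_, rfl⟩
  have hC0 : 0 < C := by rw [hC]; positivity
  refine ⟨2 + C, (1 / 4) ^ N / (2 * (64 * C) ^ N), by linarith, by positivity, ?_⟩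
  intro ε hε hε1 u h hu0
  have hex := fun (y : 𝔼) (hy : y ∈ ball (0 : 𝔼) (1 / 4)) =>
    exists_touching_point h.nonneg hu0 hε hε1 hy
  choose! c k hc hk2 hk hck using hex
  have hv := volume_unitBall_pos (N := N)
  have hbad : ∀ y ∈ ball (0 : 𝔼) (1 / 4),
      volume.real (ball (c y) ε ∩ {z | C * ε ^ 2 ≤ u z + 16 * ‖z - y‖ ^ 2 - k y}) ≤
        1 / (4 * 32 ^ N) * volume.real (ball (c y) ε) := by
    intro y hy
    have h1 := h.volume_touching_le hβ hαβ hε (ball_subset_ball (by norm_num) (hc y hy))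
      (hk y hy) (hck y hy) (C * ε ^ 2)
    rw [← hC₁] at h1
    rw [one_div_mul_eq_div, le_div_iff₀ (by positivity)]
    have h2 : 0 < C₁ * ε ^ 2 := by positivity
    rw [← mul_le_mul_iff_right₀ h2]
    calc _ = C * ε ^ 2 *
          volume.real (ball (c y) ε ∩ {z | C * ε ^ 2 ≤ u z + 16 * ‖z - y‖ ^ 2 - k y}) := by
          rw [hC]; ring
      _ ≤ _ := h1
  have hW : MeasurableSet (ball (0 : 𝔼) 1 ∩ {x | u x ≤ 2 + C}) :=
    measurableSet_ball.inter (measurableSet_le h.measurable measurable_const)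
  have key := volume_real_le_of_forall_ball (Z := ball (0 : 𝔼) (1 / 4)) (c := c)
    (r := fun _ => ε / 32) (R := ε / 32) (C := 2 * (64 * C) ^ N) (L := 1) (by positivity) hW
    (ball_subset_ball (by norm_num)) Set.inter_subset_left
    (fun _ _ => ⟨by positivity, le_rfl⟩) ?_
  · rw [volume_ball (by norm_num)] at key
    rw [div_mul_eq_mul_div, div_le_iff₀' (by positivity)]
    exact key
  · intro s hs
    have h1 : {y ∈ ball (0 : 𝔼) (1 / 4) | dist (c y) (c s) < 6 * (ε / 32)} ⊆
        ball s (2 * C * ε) := by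
      rintro y ⟨hy, hys⟩
      have := dist_vertex_le hε (show dist (c y) (c s) ≤ ε / 4 by linarith) (hk y hy) (hk s hs) (hbad y hy) (hbad s hs)
      rw [mem_ball, dist_eq_norm]
      nlinarith [mul_pos hC0 hε]
    have h2 := volume_mono h1 subset_rfl
    rw [volume_ball (by positivity)] at h2
    have hcs := mem_ball_zero_iff.1 (hc s hs)
    have h3 : ball (c s) (ε / 32) ⊆ (ball (0 : 𝔼) 1 ∩ {x | u x ≤ 2 + C}) ∩ ball (c s) (ε / 32) ∪
        (ball (c s) ε ∩ {z | C * ε ^ 2 ≤ u z + 16 * ‖z - s‖ ^ 2 - k s}) := by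
      intro z hz
      have hz' : z ∈ ball (c s) ε := ball_subset_ball (by linarith) hz
      rcases le_or_gt (C * ε ^ 2) (u z + 16 * ‖z - s‖ ^ 2 - k s) with h4 | h4
      · exact Or.inr ⟨hz', h4⟩
      · refine Or.inl ⟨⟨ball_subset_ball' (y := (0 : 𝔼)) ?_ hz', ?_⟩, hz⟩
        · rw [dist_zero_right]; linarith
        · have := hk2 s hs
          have : C * ε ^ 2 ≤ C * 1 := by gcongr; nlinarith
          have := sq_nonneg ‖z - s‖
          change u z ≤ 2 + C
          linarith
    have h4 := volume_le_add h3 Set.inter_subset_right Set.inter_subset_left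
    have h5 := hbad s hs
    rw [volume_ball (by positivity)] at h4 h5
    have h6 : (ε / 32) ^ N = ε ^ N / 32 ^ N := div_pow _ _ _
    have h7 : 1 / (4 * 32 ^ N) * (ε ^ N * volume.real (ball (0 : 𝔼) 1)) =
        1 / 4 * ((ε / 32) ^ N * volume.real (ball (0 : 𝔼) 1)) := by rw [h6]; field_simp
    have h8 : 0 < (ε / 32) ^ N * volume.real (ball (0 : 𝔼) 1) := by positivity
    calc _ ≤ _ := h2
      _ = (64 * C) ^ N * ((ε / 32) ^ N * volume.real (ball (0 : 𝔼) 1)) := by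
        rw [← mul_assoc, ← mul_pow, show 2 * C * ε = 64 * C * (ε / 32) by ring]
      _ ≤ (64 * C) ^ N * (2 * volume.real
          ((ball (0 : 𝔼) 1 ∩ {x | u x ≤ 2 + C}) ∩ ball (c s) (ε / 32))) :=
        mul_le_mul_of_nonneg_left (by linarith) (by positivity)
      _ = _ := by ring

/-- Scaled form of `exists_volume_sublevel_ge`. -/
lemma exists_volume_sublevel_ge_scaled (Λ : ℝ) {α β : ℝ} (hβ : 0 < β) (hαβ : α + β = 1) :
    ∃ M c : ℝ, 1 ≤ M ∧ 0 < c ∧ ∀ (ε r ρ t : ℝ) (u : 𝔼 → ℝ) (x : 𝔼), 0 < ε → ε ≤ r / 4 → 0 < t →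
      ρ * r ^ 2 ≤ t → IsSupersol Λ α β ε ρ u x r → u x ≤ t →
        c * volume.real (ball x r) ≤ volume.real (ball x r ∩ {y | u y ≤ M * t}) := by
  obtain ⟨M, c, hM, hc, H⟩ := exists_volume_sublevel_ge (N := N) Λ hβ hαβ
  refine ⟨M, c, hM, hc, fun ε r ρ t u x hε hεr ht hρ h hx => ?_⟩
  have hr : 0 < r := by linarith
  have h1 : IsSupersol Λ α β (ε / r) 1 (fun y => t⁻¹ * u (x + r • y)) 0 1 := by
    refine IsSupersol.mono (IsSupersol.rescale (t := t⁻¹) (R := 1) (by rwa [mul_one]) hr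
      (inv_pos.2 ht)) ?_ subset_rfl
    rw [mul_assoc, inv_mul_le_iff₀ ht, mul_one]
    exact hρ
  have h2 := H (ε / r) (by positivity) (by rw [div_le_iff₀ hr]; linarith) _ h1
    (by rw [smul_zero, add_zero, inv_mul_le_iff₀ ht, mul_one]; exact hx)
  have h3 : (fun y => x + r • y) ⁻¹' (ball x r ∩ {y | u y ≤ M * t}) =
      ball (0 : 𝔼) 1 ∩ {y | t⁻¹ * u (x + r • y) ≤ M} := by
    have := preimage_ball_rescale (x₀ := x) (x := 0) (s := 1) hr
    rw [smul_zero, add_zero, mul_one] at this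
    rw [Set.preimage_inter, this]
    congr 1
    ext y
    simp only [Set.mem_preimage, Set.mem_ofPred_eq]
    rw [inv_mul_le_iff₀ ht, mul_comm]
  rw [volume_rescale (x := x) hr (ball x r ∩ {y | u y ≤ M * t}), h3, volume_ball hr]
  calc _ = r ^ N * (c * volume.real (ball (0 : 𝔼) 1)) := by ring
    _ ≤ _ := mul_le_mul_of_nonneg_left h2 (by positivity)

/-! ### The barrier -/

lemma average_inner_sq_ge {A : ℝ} (hA : 0 ≤ A) (hx : x ≠ 0) :
    A * ‖x‖ ^ 2 / (16 * 4 ^ N) ≤ ⨍ y in ball (0 : 𝔼) 1, A * inner ℝ x y ^ 2 := by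
  have hx' : 0 < ‖x‖ := norm_pos_iff.2 hx
  have hint : IntegrableOn (fun y : 𝔼 => A * inner ℝ x y ^ 2) (ball 0 1) := by
    refine integrableOn_of_abs_le (K := A * ‖x‖ ^ 2) (by fun_prop) fun y hy => ?_
    rw [abs_mul, abs_of_nonneg hA, abs_pow]
    have h1 := abs_real_inner_le_norm x y
    have h2 := mem_ball_zero_iff.1 hy
    have h3 : |inner ℝ x y| ≤ ‖x‖ := by nlinarith [norm_nonneg y]
    gcongr
  have h1 := volume_superlevel_le_average hint (fun y _ => by positivity) (A * ‖x‖ ^ 2 / 16)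
  set p : 𝔼 := (1 / (2 * ‖x‖)) • x with hp
  have hpn : ‖p‖ = 1 / 2 := by
    rw [hp, norm_smul, Real.norm_eq_abs, abs_of_pos (by positivity)]
    field_simp
  have hxp : inner ℝ x p = ‖x‖ / 2 := by
    rw [hp, real_inner_smul_right, real_inner_self_eq_norm_sq]
    field_simp
  have hsub : ball p (1 / 4) ⊆ {y | A * ‖x‖ ^ 2 / 16 ≤ A * inner ℝ x y ^ 2} ∩ ball 0 1 := by
    intro y hy
    refine ⟨?_, ball_subset_ball' (by rw [dist_zero_right, hpn]; norm_num) hy⟩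
    have h2 : |inner ℝ x (y - p)| ≤ ‖x‖ * (1 / 4) := by
      refine (abs_real_inner_le_norm _ _).trans ?_
      rw [← dist_eq_norm]
      exact mul_le_mul_of_nonneg_left (mem_ball.1 hy).le hx'.le
    rw [inner_sub_right, hxp] at h2
    have h3 : ‖x‖ / 4 ≤ inner ℝ x y := by linarith [(abs_le.1 h2).1]
    have h4 : (‖x‖ / 4) ^ 2 ≤ inner ℝ x y ^ 2 := by gcongr
    calc A * ‖x‖ ^ 2 / 16 = A * (‖x‖ / 4) ^ 2 := by ring
      _ ≤ _ := mul_le_mul_of_nonneg_left h4 hA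
  have h2 := volume_mono hsub Set.inter_subset_right
  rw [volume_ball (by norm_num)] at h2
  have hv := volume_unitBall_pos (N := N)
  rw [← mul_le_mul_iff_left₀ hv]
  refine le_trans ?_ h1
  calc _ = A * ‖x‖ ^ 2 / 16 * ((1 / 4) ^ N * volume.real (ball (0 : 𝔼) 1)) := by
        rw [one_div, inv_pow]; field_simp
    _ ≤ _ := mul_le_mul_of_nonneg_left h2 (by positivity)

lemma ddiff_gaussian_ge {μ b : ℝ} {h : 𝔼} (hh : μ * ‖h‖ ^ 2 ≤ 1 / 2) :
    2 * Real.exp (-μ * ‖x‖ ^ 2) * (μ ^ 2 * inner ℝ x h ^ 2 - μ * ‖h‖ ^ 2) ≤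
      ddiff (fun z => Real.exp (-μ * ‖z‖ ^ 2) - b) x h := by
  have h1 : Real.exp (-μ * ‖x + h‖ ^ 2) = Real.exp (-μ * ‖x‖ ^ 2) *
      (Real.exp (-(μ * ‖h‖ ^ 2)) * Real.exp (-(2 * μ * inner ℝ x h))) := by
    rw [norm_add_sq_real, ← Real.exp_add, ← Real.exp_add]; congr 1; ring
  have h2 : Real.exp (-μ * ‖x - h‖ ^ 2) = Real.exp (-μ * ‖x‖ ^ 2) *
      (Real.exp (-(μ * ‖h‖ ^ 2)) * Real.exp (2 * μ * inner ℝ x h)) := by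
    rw [norm_sub_sq_real, ← Real.exp_add, ← Real.exp_add]; congr 1; ring
  have h3 := Real.add_one_le_exp (-(μ * ‖h‖ ^ 2))
  have h4 : 2 + (2 * μ * inner ℝ x h) ^ 2 ≤
      Real.exp (2 * μ * inner ℝ x h) + Real.exp (-(2 * μ * inner ℝ x h)) := by
    have hq := Real.cosh_two_mul (μ * inner ℝ x h)
    have hq' : (μ * inner ℝ x h) ^ 2 ≤ Real.sinh (μ * inner ℝ x h) ^ 2 := by
      rcases le_total 0 (μ * inner ℝ x h) with h0 | h0
      · have := Real.self_le_sinh_iff.2 h0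
        gcongr
      · have := Real.sinh_le_self_iff.2 h0
        nlinarith
    rw [Real.cosh_sq, Real.cosh_eq, ← mul_assoc] at hq
    linarith
  have h5 : μ ^ 2 * inner ℝ x h ^ 2 - μ * ‖h‖ ^ 2 ≤ (Real.exp (-(μ * ‖h‖ ^ 2)) *
      (Real.exp (2 * μ * inner ℝ x h) + Real.exp (-(2 * μ * inner ℝ x h))) - 2) / 2 := by
    have h6 := mul_le_mul h3 h4 (by positivity) (Real.exp_pos _).le
    nlinarith [sq_nonneg (μ * inner ℝ x h)]
  have h7 := mul_le_mul_of_nonneg_left h5 (Real.exp_pos (-μ * ‖x‖ ^ 2)).le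
  simp only [ddiff]
  rw [h1, h2]
  linarith

set_option maxHeartbeats 1000000 in
/-- A supersolution that is at least one in the unit ball is bounded below in `B_2`. -/
lemma exists_le_of_one_le_ball (Λ : ℝ) {α β : ℝ} (hα : 0 ≤ α) (hβ : 0 < β) (hαβ : α + β = 1) :
    ∃ c ε₁ : ℝ, 0 < c ∧ c < 1 ∧ 0 < ε₁ ∧ ∀ ε : ℝ, 0 < ε → ε ≤ ε₁ → ∀ u : 𝔼 → ℝ,
      IsSupersol Λ α β ε c u 0 3 → (∀ x ∈ ball (0 : 𝔼) 1, 1 ≤ u x) →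
        ∀ x ∈ ball (0 : 𝔼) 2, c ≤ u x := by
  obtain ⟨κ, hκ⟩ : ∃ κ : ℝ, κ = 1 / (16 * 4 ^ N) := ⟨_, rfl⟩
  have hκ0 : 0 < κ := by rw [hκ]; positivity
  obtain ⟨μ, hμ⟩ : ∃ μ : ℝ, μ = (1 + β + α * Λ ^ 2) / (β * κ) := ⟨_, rfl⟩
  have hμ0 : 0 < μ := by rw [hμ]; positivity
  have hμ1 : β * (μ * κ) = 1 + β + α * Λ ^ 2 := by rw [hμ]; field_simp
  have hexp : Real.exp (-μ * 9) < Real.exp (-μ * 4) := Real.exp_lt_exp.2 (by linarith)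
  obtain ⟨c, hc⟩ : ∃ c : ℝ, c = min (Real.exp (-μ * 4) - Real.exp (-μ * 9))
    (min (μ * Real.exp (-μ * 9) / 2) (1 / 2)) := ⟨_, rfl⟩
  have hc1 : c ≤ Real.exp (-μ * 4) - Real.exp (-μ * 9) := hc ▸ min_le_left _ _
  have hc2 : c ≤ μ * Real.exp (-μ * 9) / 2 := hc ▸ (min_le_right _ _).trans (min_le_left _ _)
  have hc3 : c ≤ 1 / 2 := hc ▸ (min_le_right _ _).trans (min_le_right _ _)
  have hc0 : 0 < c := by
    rw [hc]; exact lt_min (by linarith) (lt_min (by positivity) (by norm_num))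
  refine ⟨c, 1 / (2 * μ * (Λ ^ 2 + 1) + 1), hc0, by linarith, by positivity, ?_⟩
  intro ε hε hε1 u h hu1 x₁ hx₁
  rw [le_div_iff₀ (by positivity)] at hε1
  have hε2 : μ * ((Λ ^ 2 + 1) * ε ^ 2) ≤ 1 / 2 := by
    have h1 : 0 < 2 * μ * (Λ ^ 2 + 1) := by positivity
    have h2 : ε ≤ 1 := by nlinarith [mul_pos hε h1]
    nlinarith [mul_pos hε h1]
  by_contra! hlt
  obtain ⟨ψ, hψ⟩ : ∃ ψ : 𝔼 → ℝ, ψ = fun z => Real.exp (-μ * ‖z‖ ^ 2) - Real.exp (-μ * 9) :=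
    ⟨_, rfl⟩
  have hψz : ∀ z, ψ z = Real.exp (-μ * ‖z‖ ^ 2) - Real.exp (-μ * 9) := fun z => by rw [hψ]
  have hexp1 : ∀ z : 𝔼, Real.exp (-μ * ‖z‖ ^ 2) ≤ 1 := fun z =>
    Real.exp_le_one_iff.2 (by nlinarith [sq_nonneg ‖z‖])
  have hbdd : BddBelow (Set.range fun z => u z - ψ z) := by
    refine ⟨-1, ?_⟩
    rintro _ ⟨z, rfl⟩
    have := h.nonneg z
    have := hexp1 z
    have := Real.exp_pos (-μ * 9)
    simp only [hψz]
    linarith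
  obtain ⟨d, hd⟩ : ∃ d, d = ⨅ z, (u z - ψ z) := ⟨_, rfl⟩
  have hdle : ∀ z, d ≤ u z - ψ z := fun z => hd ▸ ciInf_le hbdd z
  have hd0 : d < 0 := by
    have h1 := hdle x₁
    have h2 : Real.exp (-μ * 4) ≤ Real.exp (-μ * ‖x₁‖ ^ 2) := by
      refine Real.exp_le_exp.2 ?_
      have : ‖x₁‖ ^ 2 ≤ 4 := by nlinarith [mem_ball_zero_iff.1 hx₁, norm_nonneg x₁]
      nlinarith
    rw [hψz] at h1
    linarith
  obtain ⟨η, hη⟩ : ∃ η : ℝ, η = min (-d) (ε ^ 2 * μ * Real.exp (-μ * 9) / 4) := ⟨_, rfl⟩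
  have hη0 : 0 < η := by rw [hη]; exact lt_min (by linarith) (by positivity)
  have hη1 : η ≤ -d := hη ▸ min_le_left _ _
  have hη2 : η ≤ ε ^ 2 * μ * Real.exp (-μ * 9) / 4 := hη ▸ min_le_right _ _
  obtain ⟨x, hx⟩ := exists_lt_of_ciInf_lt (show ⨅ z, (u z - ψ z) < d + η by linarith)
  have hx3 : ‖x‖ < 3 := by
    by_contra! h3
    have h3' : 9 ≤ ‖x‖ ^ 2 := by nlinarith
    have h4 : Real.exp (-μ * ‖x‖ ^ 2) ≤ Real.exp (-μ * 9) := Real.exp_le_exp.2 (by nlinarith)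
    have h5 := h.nonneg x
    rw [hψz] at hx
    linarith
  have hx1 : 1 ≤ ‖x‖ := by
    by_contra! h3
    have h4 := hu1 x (mem_ball_zero_iff.2 h3)
    have h5 := hexp1 x
    have h6 := Real.exp_pos (-μ * 9)
    rw [hψz] at hx
    linarith
  obtain ⟨e, he⟩ : ∃ e, e = Real.exp (-μ * ‖x‖ ^ 2) := ⟨_, rfl⟩
  have he0 : 0 < e := he ▸ Real.exp_pos _
  have hx9 : ‖x‖ ^ 2 ≤ 9 := by nlinarith
  have he9 : Real.exp (-μ * 9) ≤ e := he ▸ Real.exp_le_exp.2 (by nlinarith)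
  have hdd : ∀ h : 𝔼, μ * ‖h‖ ^ 2 ≤ 1 / 2 →
      2 * e * (μ ^ 2 * inner ℝ x h ^ 2 - μ * ‖h‖ ^ 2) - 2 * η ≤ ddiff u x h := by
    intro h hh
    have h1 := ddiff_gaussian_ge (x := x) (b := Real.exp (-μ * 9)) hh
    have h2 := hdle (x + h)
    have h3 := hdle (x - h)
    rw [← he, ← hψ] at h1
    simp only [ddiff] at h1 ⊢
    linarith
  have hnorm : ∀ z : 𝔼, ∀ s, s ^ 2 ≤ Λ ^ 2 + 1 → z ∈ ball (0 : 𝔼) s →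
      ‖ε • z‖ ^ 2 ≤ s ^ 2 * ε ^ 2 ∧ μ * ‖ε • z‖ ^ 2 ≤ 1 / 2 := by
    intro z s hs hz
    rw [mem_ball_zero_iff] at hz
    have h1 : ‖ε • z‖ ^ 2 ≤ s ^ 2 * ε ^ 2 := by
      rw [norm_smul, mul_pow, Real.norm_eq_abs, sq_abs, mul_comm]
      gcongr
    refine ⟨h1, le_trans ?_ hε2⟩
    refine mul_le_mul_of_nonneg_left (h1.trans ?_) hμ0.le
    gcongr
  have hm := h.superAt x (mem_ball_zero_iff.2 hx3) (-(2 * e * μ * (Λ ^ 2 * ε ^ 2)) - 2 * η)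
    fun z hz => by
      obtain ⟨h1, h2⟩ := hnorm z Λ (by linarith) hz
      refine le_trans ?_ (hdd _ h2)
      have h3 := mul_le_mul_of_nonneg_left h1 (show 0 ≤ 2 * e * μ by positivity)
      have h4 : 0 ≤ 2 * e * (μ ^ 2 * inner ℝ x (ε • z) ^ 2) := by positivity
      linarith
  obtain ⟨K, hK⟩ := h.bounded
  have hA : (0 : ℝ) ≤ 2 * e * μ ^ 2 * ε ^ 2 := by positivity
  have hav : (⨍ y in ball (0 : 𝔼) 1, 2 * e * μ ^ 2 * ε ^ 2 * inner ℝ x y ^ 2) ≤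
      (⨍ y in ball (0 : 𝔼) 1, ddiff u x (ε • y)) + (2 * e * μ * ε ^ 2 + 2 * η) := by
    refine average_le_average_add ?_ (integrableOn_ddiff h.measurable hε fun z _ => hK z)
      fun y hy => ?_
    · refine integrableOn_of_abs_le (K := 2 * e * μ ^ 2 * ε ^ 2 * ‖x‖ ^ 2) (by fun_prop)
        fun y hy => ?_
      rw [abs_mul, abs_of_nonneg hA, abs_pow]
      have h1 := abs_real_inner_le_norm x y
      have h2 := mem_ball_zero_iff.1 hy
      have h3 : |inner ℝ x y| ≤ ‖x‖ := by nlinarith [norm_nonneg y]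
      gcongr
    · obtain ⟨h1, h2⟩ := hnorm y 1 (by nlinarith [sq_nonneg Λ]) hy
      have h3 := hdd _ h2
      have h4 := mul_le_mul_of_nonneg_left h1 (show 0 ≤ 2 * e * μ by positivity)
      rw [real_inner_smul_right] at h3
      linarith
  have hin := average_inner_sq_ge hA (x := x) (norm_pos_iff.1 (by linarith))
  have hin2 : 2 * e * μ ^ 2 * ε ^ 2 * κ ≤
      ⨍ y in ball (0 : 𝔼) 1, 2 * e * μ ^ 2 * ε ^ 2 * inner ℝ x y ^ 2 := by
    refine le_trans ?_ hin
    rw [hκ, mul_one_div]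
    exact div_le_div_of_nonneg_right (le_mul_of_one_le_right hA (by nlinarith)) (by positivity)
  have hβm := mul_le_mul_of_nonneg_left (hin2.trans hav) hβ.le
  have hε0 : 0 < ε ^ 2 := by positivity
  have hfin : 2 * e * μ * ε ^ 2 - 2 * η ≤ 2 * ε ^ 2 * c := by
    have h1 : β * (2 * e * μ ^ 2 * ε ^ 2 * κ) = 2 * e * μ * ε ^ 2 * (β * (μ * κ)) := by ring
    rw [h1, hμ1] at hβm
    have h2 : α * η + β * η = η := by rw [← add_mul, hαβ, one_mul]
    obtain ⟨a, ha⟩ : ∃ a, a = ⨍ y in ball (0 : 𝔼) 1, ddiff u x (ε • y) := ⟨_, rfl⟩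
    rw [← ha] at hβm hm
    linarith
  have h8 : 2 * ε ^ 2 * c ≤ 2 * ε ^ 2 * (μ * Real.exp (-μ * 9) / 2) := by gcongr
  have h9 : 2 * Real.exp (-μ * 9) * μ * ε ^ 2 ≤ 2 * e * μ * ε ^ 2 := by gcongr
  have h10 : 0 < ε ^ 2 * μ * Real.exp (-μ * 9) := by positivity
  linarith

/-- Scaled form of `exists_le_of_one_le_ball`. -/
lemma exists_le_of_le_ball_scaled (Λ : ℝ) {α β : ℝ} (hα : 0 ≤ α) (hβ : 0 < β) (hαβ : α + β = 1) :
    ∃ c ε₁ : ℝ, 0 < c ∧ c < 1 ∧ 0 < ε₁ ∧ ∀ (ε r ρ t : ℝ) (u : 𝔼 → ℝ) (x : 𝔼), 0 < ε → 0 < r →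
      ε ≤ ε₁ * r → 0 < t → ρ * r ^ 2 ≤ c * t → IsSupersol Λ α β ε ρ u x (3 * r) →
        (∀ y ∈ ball x r, t ≤ u y) → ∀ y ∈ ball x (2 * r), c * t ≤ u y := by
  obtain ⟨c, ε₁, hc, hc1, hε₁, H⟩ := exists_le_of_one_le_ball (N := N) Λ hα hβ hαβ
  refine ⟨c, ε₁, hc, hc1, hε₁, fun ε r ρ t u x hε hr hεr ht hρ h hu y hy => ?_⟩
  have h1 : IsSupersol Λ α β (ε / r) c (fun y => t⁻¹ * u (x + r • y)) 0 3 := by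
    refine IsSupersol.mono (IsSupersol.rescale (t := t⁻¹) (R := 3) (by rwa [mul_comm]) hr
      (inv_pos.2 ht)) ?_ subset_rfl
    rwa [mul_assoc, inv_mul_le_iff₀ ht, mul_comm t]
  have hmem : ∀ s : ℝ, ∀ z : 𝔼, x + r • z ∈ ball x (s * r) ↔ z ∈ ball (0 : 𝔼) s := by
    intro s z
    have := preimage_ball_rescale (x₀ := x) (x := 0) (s := s) hr
    rw [smul_zero, add_zero] at this
    rw [← this, Set.mem_preimage, mul_comm]
  have h2 := H (ε / r) (by positivity) ((div_le_iff₀ hr).2 hεr) _ h1 (fun z hz => by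
      rw [le_inv_mul_iff₀ ht, mul_one]
      exact hu _ (by simpa only [one_mul] using (hmem 1 z).2 hz)) (r⁻¹ • (y - x))
  have hyr : x + r • r⁻¹ • (y - x) = y := by
    rw [smul_smul, mul_inv_cancel₀ hr.ne', one_smul, add_sub_cancel]
  have h3 := h2 ((hmem 2 _).1 (by rwa [hyr]))
  simp only [hyr] at h3
  rwa [le_inv_mul_iff₀ ht, mul_comm] at h3

/-- Propagation of lower bounds from a small ball to a ball of radius three. -/
lemma exists_pow_mul_le_of_le_ball (Λ : ℝ) {α β : ℝ} (hα : 0 ≤ α) (hβ : 0 < β)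
    (hαβ : α + β = 1) :
    ∃ c ε₁ : ℝ, 0 < c ∧ c < 1 ∧ 0 < ε₁ ∧ ∀ (n : ℕ) (ε ρ t : ℝ) (u : 𝔼 → ℝ) (x : 𝔼), 0 < ε →
      ε ≤ ε₁ / 2 ^ n → 0 < t → ρ ≤ c ^ n * t → IsSupersol Λ α β ε ρ u x 5 →
        (∀ y ∈ ball x (3 / 2 ^ n), t ≤ u y) → ∀ y ∈ ball x 3, c ^ n * t ≤ u y := by
  obtain ⟨c, ε₁, hc, hc1, hε₁, H⟩ := exists_le_of_le_ball_scaled (N := N) Λ hα hβ hαβ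
  refine ⟨c / 3, ε₁, by positivity, by linarith, hε₁, fun n => ?_⟩
  induction n with
  | zero =>
    intro ε ρ t u x _ _ _ _ _ hu
    simpa using hu
  | succ n ih =>
    intro ε ρ t u x hε hεn ht hρ h hu
    have h2 : (0 : ℝ) < 2 ^ n := by positivity
    have h2' : (1 : ℝ) ≤ 2 ^ n := one_le_pow₀ (by norm_num)
    have hr : (3 : ℝ) / 2 ^ (n + 1) ≤ 3 / 2 := by
      rw [pow_succ]
      exact div_le_div_of_nonneg_left (by norm_num) (by norm_num) (by linarith)
    have hr0 : (0 : ℝ) < 3 / 2 ^ (n + 1) := by positivity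
    have hcn : (c / 3) ^ n ≤ 1 := pow_le_one₀ (by positivity) (by linarith)
    have hct : (c / 3) ^ (n + 1) * t = (c / 3) ^ n * (c / 3 * t) := by ring
    have h3 : (c / 3) ^ n * (c / 3 * t) ≤ c / 3 * t := mul_le_of_le_one_left (by positivity) hcn
    have h4 := H ε (3 / 2 ^ (n + 1)) ρ t u x hε hr0 ?_ ht ?_
      (h.mono le_rfl (ball_subset_ball (by linarith))) hu
    · rw [hct]
      refine ih ε ρ (c / 3 * t) u x hε (hεn.trans ?_) (by positivity) (hct ▸ hρ) h
        fun y hy => ?_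
      · rw [pow_succ]
        exact div_le_div_of_nonneg_left hε₁.le h2 (by linarith)
      · refine le_trans ?_ (h4 y ?_)
        · nlinarith [mul_pos hc ht]
        · rw [pow_succ]
          convert hy using 2
          field_simp
    · refine hεn.trans ?_
      rw [← mul_div_assoc]
      exact div_le_div_of_nonneg_right (by linarith) (by positivity)
    · have h5 : (3 / 2 ^ (n + 1)) ^ 2 ≤ (3 / 2 : ℝ) ^ 2 := by gcongr
      calc ρ * (3 / 2 ^ (n + 1)) ^ 2 ≤ c / 3 * t * (3 / 2 ^ (n + 1)) ^ 2 :=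
            mul_le_mul_of_nonneg_right (by linarith) (by positivity)
        _ ≤ c / 3 * t * (3 / 2) ^ 2 := mul_le_mul_of_nonneg_left h5 (by positivity)
        _ ≤ c * t := by nlinarith [mul_pos hc ht]

lemma IsSupersol.le_of_volume_superlevel {θ t : ℝ} (h : IsSupersol Λ α β ε ρ u x₀ R) (hα : 0 ≤ α)
    (hβ : 0 < β) (hαβ : α + β = 1) (hε : 0 < ε) (hx : x ∈ ball x₀ R) (ht : 0 < t)
    (hρ : ρ * ε ^ 2 ≤ β * θ / 4 * t)
    (hθ : θ * volume.real (ball x ε) ≤ volume.real (ball x ε ∩ {y | t ≤ u y})) :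
    β * θ / 4 * t ≤ u x := by
  have h1 := h.volume_superlevel_le hα hβ hαβ hε hx t
  have hV : 0 < volume.real (ball x ε) := by
    rw [volume_ball hε]; exact mul_pos (by positivity) volume_unitBall_pos
  have h2 : β / 2 * (t * (θ * volume.real (ball x ε))) ≤
      (ε ^ 2 * ρ + u x) * volume.real (ball x ε) := le_trans (by gcongr) h1
  have h3 : β / 2 * (t * θ) ≤ ε ^ 2 * ρ + u x := by
    refine le_of_mul_le_mul_right ?_ hV
    linarith
  linarith

/-- Lower bounds of high density in a ball propagate to a slightly larger ball. -/
lemma exists_le_of_volume_diff_le (Λ : ℝ) {α β : ℝ} (hα : 0 ≤ α) (hβ : 0 < β)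
    (hαβ : α + β = 1) :
    ∃ δ c : ℝ, 0 < δ ∧ δ < 1 ∧ 0 < c ∧ c < 1 ∧ ∀ (ε r ρ t : ℝ) (u : 𝔼 → ℝ) (x : 𝔼), 0 < ε →
      ε ≤ 1 → ε / 4 ≤ r → r ≤ 1 → 0 < t → ρ ≤ c * t → IsSupersol Λ α β ε ρ u x 6 →
        volume.real (ball x r \ {y | t ≤ u y}) ≤ δ * volume.real (ball x r) →
          ∀ y ∈ ball x (r + ε / 4), c * t ≤ u y := by
  obtain ⟨M, a, hM, ha, HA⟩ := exists_volume_sublevel_ge_scaled (N := N) Λ hβ hαβ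
  obtain ⟨d, ε₁, hd, hd1, hε₁, HD⟩ := exists_le_of_le_ball_scaled (N := N) Λ hα hβ hαβ
  obtain ⟨K, hK⟩ : ∃ K : ℝ, K = max 8 (2 / ε₁) := ⟨_, rfl⟩
  have hK8 : 8 ≤ K := hK ▸ le_max_left _ _
  have hKε : 2 ≤ ε₁ * K := by
    rw [mul_comm, ← div_le_iff₀ hε₁]; exact hK ▸ le_max_right _ _
  obtain ⟨θ, hθ⟩ : ∃ θ : ℝ, θ = 1 / (2 * 8 ^ N) := ⟨_, rfl⟩
  have hθ0 : 0 < θ := hθ ▸ by positivity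
  obtain ⟨δ, hδ⟩ : ∃ δ : ℝ, δ = min (a / (2 * 2 ^ N)) (min (1 / 2 * (1 / (8 * K)) ^ N) (1 / 2)) :=
    ⟨_, rfl⟩
  have hδ0 : 0 < δ := by rw [hδ]; exact lt_min (by positivity) (lt_min (by positivity) (by norm_num))
  have hδ1 : δ ≤ a / (2 * 2 ^ N) := hδ ▸ min_le_left _ _
  have hδ2 : δ ≤ 1 / 2 * (1 / (8 * K)) ^ N := hδ ▸ (min_le_right _ _).trans (min_le_left _ _)
  have hδ3 : δ ≤ 1 / 2 := hδ ▸ (min_le_right _ _).trans (min_le_right _ _)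
  obtain ⟨c, hc⟩ : ∃ c : ℝ, c = min (d * (d * (1 / (2 * M)))) (β * θ / 4) := ⟨_, rfl⟩
  have hc0 : 0 < c := by rw [hc]; exact lt_min (by positivity) (by positivity)
  have hc1 : c ≤ d * (d * (1 / (2 * M))) := hc ▸ min_le_left _ _
  have hc2 : c ≤ β * θ / 4 := hc ▸ min_le_right _ _
  have hM0 : 0 < M := by linarith
  have hM1 : 1 / (2 * M) ≤ 1 / 2 := one_div_le_one_div_of_le (by norm_num) (by linarith)
  have hM2 : 0 < 1 / (2 * M) := by positivity
  have hc3 : c ≤ d * (1 / (2 * M)) :=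
    hc1.trans (mul_le_of_le_one_left (by positivity) hd1.le)
  have hc4 : c ≤ 1 / (2 * M) := hc3.trans (mul_le_of_le_one_left (by positivity) hd1.le)
  refine ⟨δ, c, hδ0, by linarith, hc0, by linarith, ?_⟩
  intro ε r ρ t u x hε hε1 hεr hr1 ht hρ h hvol y hy
  have hr : 0 < r := by linarith
  have hct : 0 < c * t := by positivity
  have hρs : ∀ s : ℝ, 0 ≤ s → s ≤ 1 → ρ * s ^ 2 ≤ c * t := fun s hs hs1 =>
    (mul_le_mul_of_nonneg_right hρ (sq_nonneg s)).trans
      (mul_le_of_le_one_right hct.le (pow_le_one₀ hs hs1))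
  have hV := volume_unitBall_pos (N := N)
  rcases le_or_gt (K * ε) r with hKr | hKr
  · have hεr8 : ε ≤ r / 8 := by nlinarith
    have hεr1 : ε ≤ ε₁ * (r / 2) := by
      have h1 := mul_le_mul_of_nonneg_right hKε hε.le
      have h2 := mul_le_mul_of_nonneg_left hKr hε₁.le
      linarith
    have hstep : ∀ y ∈ ball x (r / 2), 1 / (2 * M) * t ≤ u y := by
      intro y hy
      by_contra! hlt
      have hsub : ball y (r / 2) ⊆ ball x r :=
        ball_subset_ball' (by have := mem_ball.1 hy; linarith)
      have h1 := HA ε (r / 2) ρ (1 / (2 * M) * t) u y hε (by linarith) (by positivity)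
        ((hρs _ (by positivity) (by linarith)).trans (by gcongr))
        (h.mono le_rfl (hsub.trans (ball_subset_ball (by linarith)))) hlt.le
      have h2 : ball y (r / 2) ∩ {z | u z ≤ M * (1 / (2 * M) * t)} ⊆ ball x r \ {z | t ≤ u z} := by
        rintro z ⟨hz, hz2⟩
        have h3 : M * (1 / (2 * M) * t) = t / 2 := by field_simp
        rw [Set.mem_ofPred_eq, h3] at hz2
        exact ⟨hsub hz, fun (h4 : t ≤ u z) => by linarith⟩
      have h5 := (h1.trans (volume_mono h2 Set.sdiff_subset)).trans hvol
      rw [volume_ball (by positivity), volume_ball hr] at h5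
      have h6 : a * ((r / 2) ^ N * volume.real (ball (0 : 𝔼) 1)) =
          2 * (a / (2 * 2 ^ N) * (r ^ N * volume.real (ball (0 : 𝔼) 1))) := by
        rw [div_pow]; field_simp
      have h7 : 0 < r ^ N * volume.real (ball (0 : 𝔼) 1) := by positivity
      have h8 := mul_le_mul_of_nonneg_right hδ1 h7.le
      have h9 : 0 < a / (2 * 2 ^ N) * (r ^ N * volume.real (ball (0 : 𝔼) 1)) := by positivity
      linarith
    have h1 := HD ε (r / 2) ρ (1 / (2 * M) * t) u x hε (by positivity) hεr1 (by positivity)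
      ((hρs _ (by positivity) (by linarith)).trans (by rw [← mul_assoc]; gcongr))
      (h.mono le_rfl (ball_subset_ball (by linarith))) hstep
    have h2 := HD ε r ρ (d * (1 / (2 * M) * t)) u x hε hr (by nlinarith) (by positivity)
      ((hρs _ hr.le hr1).trans
        (by rw [← mul_assoc d (1 / (2 * M)), ← mul_assoc d (d * _)]; gcongr))
      (h.mono le_rfl (ball_subset_ball (by linarith)))
      (fun z hz => h1 z (by rwa [mul_div_cancel₀ r two_ne_zero]))
    refine le_trans ?_ (h2 y (ball_subset_ball (by linarith) hy))
    rw [← mul_assoc d (1 / (2 * M)), ← mul_assoc d (d * _)]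
    gcongr
  · refine le_trans (mul_le_mul_of_nonneg_right hc2 ht.le)
      (h.le_of_volume_superlevel (θ := θ) hα hβ hαβ hε (ball_subset_ball (by linarith) hy) ht
      ((hρs ε hε.le hε1).trans (by gcongr)) ?_)
    obtain ⟨s, hs⟩ : ∃ s : ℝ, s = (r - ε / 8) / (r + ε / 4) := ⟨_, rfl⟩
    have hs0 : 0 < s := by rw [hs]; exact div_pos (by linarith) (by linarith)
    have hs1 : s * (r + ε / 4) = r - ε / 8 := by rw [hs]; field_simp
    have hs2 : s < 1 := by rw [hs, div_lt_one (by linarith)]; linarith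
    obtain ⟨p, hp⟩ : ∃ p : 𝔼, p = x + s • (y - x) := ⟨_, rfl⟩
    rw [mem_ball, dist_eq_norm] at hy
    have hpx : ball p (ε / 8) ⊆ ball x r := by
      refine ball_subset_ball' ?_
      rw [dist_eq_norm, hp, add_sub_cancel_left, norm_smul, Real.norm_eq_abs, abs_of_pos hs0]
      have := mul_lt_mul_of_pos_left hy hs0
      linarith
    have hpy : ball p (ε / 8) ⊆ ball y ε := by
      refine ball_subset_ball' ?_
      have : p - y = (1 - s) • (x - y) := by rw [hp]; module
      rw [dist_eq_norm, this, norm_smul, Real.norm_eq_abs, abs_of_pos (by linarith), norm_sub_rev]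
      have := mul_lt_mul_of_pos_left hy (sub_pos.2 hs2)
      linarith
    have h1 : volume.real (ball p (ε / 8)) ≤ volume.real (ball y ε ∩ {z | t ≤ u z}) +
        volume.real (ball x r \ {z | t ≤ u z}) := by
      refine volume_le_add (fun z hz => ?_) Set.inter_subset_left Set.sdiff_subset
      by_cases hz' : t ≤ u z
      · exact Or.inl ⟨hpy hz, hz'⟩
      · exact Or.inr ⟨hpx hz, hz'⟩
    have h2 : δ * volume.real (ball x r) ≤ 1 / 2 * volume.real (ball p (ε / 8)) := by
      rw [volume_ball hr, volume_ball (show 0 < ε / 8 by positivity)]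
      have h3 : δ * r ^ N ≤ 1 / 2 * (1 / (8 * K)) ^ N * (K * ε) ^ N := by gcongr
      have h4 : (1 / (8 * K)) ^ N * (K * ε) ^ N = (ε / 8) ^ N := by
        rw [← mul_pow]; congr 1; field_simp
      rw [mul_assoc (1 / 2), h4] at h3
      have := mul_le_mul_of_nonneg_right h3 hV.le
      linarith
    have h3 : θ * volume.real (ball y ε) = 1 / 2 * volume.real (ball p (ε / 8)) := by
      rw [volume_ball hε, volume_ball (show 0 < ε / 8 by positivity), hθ, div_pow]; field_simp
    linarith

/-! ### Growing ink spots -/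

/-- The points of low density at a fixed scale form a small set. -/
lemma volume_low_density_le {A : Set 𝔼} {κ s L : ℝ} (hκ : 0 ≤ κ) (hs : 0 < s) (hA : A ⊆ ball 0 L) :
    volume.real {x ∈ A | volume.real (A ∩ ball x s) ≤ κ * volume.real (ball x s)} ≤
      κ * 6 ^ N * volume.real (ball (0 : 𝔼) (L + s)) := by
  have hL : ball (0 : 𝔼) L ⊆ ball 0 (L + s) := ball_subset_ball (by linarith)
  refine volume_real_le_of_forall_ball (c := id) (r := fun _ => s / 6) (R := s / 6) (L := L + s)
    (by positivity) measurableSet_ball (fun x hx => hL (hA hx.1)) subset_rfl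
    (fun _ _ => ⟨by positivity, le_rfl⟩) fun x hx => ?_
  have h1 : ball x (s / 6) ⊆ ball (0 : 𝔼) (L + s) :=
    ball_subset_ball' (by have := mem_ball.1 (hA hx.1); linarith)
  simp only [id]
  rw [Set.inter_eq_self_of_subset_right h1, mul_div_cancel₀ s (by norm_num : (6 : ℝ) ≠ 0)]
  refine ((volume_mono ?_ Set.inter_subset_right).trans hx.2).trans (le_of_eq ?_)
  · exact fun y hy => ⟨hy.1.1, mem_ball.2 hy.2⟩
  · rw [volume_ball hs, volume_ball (show 0 < s / 6 by positivity), div_pow]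
    field_simp

/-- Points carrying a ball inside `F` in which `A` has deficient density. -/
lemma volume_le_of_deficient {A F Z : Set 𝔼} {δ L R : ℝ} {r : 𝔼 → ℝ} (hδ : 0 < δ)
    (hA : MeasurableSet A) (hF : MeasurableSet F) (hFL : F ⊆ ball 0 L)
    (hr : ∀ x ∈ Z, 0 < r x ∧ r x ≤ R) (hrF : ∀ x ∈ Z, ball x (r x) ⊆ F)
    (h : ∀ x ∈ Z, δ * volume.real (ball x (r x)) ≤ volume.real (ball x (r x) \ A)) :
    volume.real Z ≤ 6 ^ N / δ * volume.real (F \ A) := by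
  refine volume_real_le_of_forall_ball (c := id) (r := r) (R := R) (L := L) (by positivity)
    (hF.diff hA) (fun x hx => hFL (hrF x hx (mem_ball_self (hr x hx).1)))
    (Set.sdiff_subset.trans hFL) hr fun x hx => ?_
  have hx0 := (hr x hx).1
  have h1 : volume.real {y ∈ Z | dist (id y) (id x) < 6 * r x} ≤
      volume.real (ball x (6 * r x)) := volume_mono (fun y hy => mem_ball.2 hy.2) subset_rfl
  have h2 : volume.real (ball x (r x) \ A) ≤ volume.real (F \ A ∩ ball (id x) (r x)) :=
    volume_mono (fun y hy => ⟨⟨hrF x hx hy.1, hy.2⟩, hy.1⟩) Set.inter_subset_right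
  calc _ ≤ volume.real (ball x (6 * r x)) := h1
    _ = 6 ^ N / δ * (δ * volume.real (ball x (r x))) := by
      rw [volume_ball (by positivity), volume_ball hx0, mul_pow]; field_simp
    _ ≤ _ := mul_le_mul_of_nonneg_left ((h x hx).trans h2) (by positivity)

/-- Either the superlevel set grows or it contains a ball of definite size. -/
lemma exists_volume_superlevel_growth (Λ : ℝ) {α β : ℝ} (hα : 0 ≤ α) (hβ : 0 < β)
    (hαβ : α + β = 1) :
    ∃ σ c : ℝ, 0 < σ ∧ 0 < c ∧ c < 1 ∧ ∀ (ε s S ρ t : ℝ) (u : 𝔼 → ℝ), 0 < ε → ε ≤ 1 → ε ≤ s →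
      s ≤ 1 → 0 < t → ρ ≤ c * t → IsSupersol Λ α β ε ρ u 0 12 → S + s ≤ 2 →
        1 / 2 * volume.real (ball (0 : 𝔼) 1) ≤ volume.real ({y | t ≤ u y} ∩ ball 0 S) →
          (∃ x ∈ ball (0 : 𝔼) 2, ∀ y ∈ ball x s, c * t ≤ u y) ∨
          volume.real ({y | t ≤ u y} ∩ ball 0 S) + σ * volume.real (ball (0 : 𝔼) 1) ≤
            volume.real ({y | c * t ≤ u y} ∩ ball 0 (S + s)) := by
  obtain ⟨δ, b, hδ, hδ1, hb, hb1, HE⟩ := exists_le_of_volume_diff_le (N := N) Λ hα hβ hαβ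
  obtain ⟨κ, hκ⟩ : ∃ κ : ℝ, κ = 1 / (4 * 24 ^ N) := ⟨_, rfl⟩
  have hκ0 : 0 < κ := hκ ▸ by positivity
  obtain ⟨c, hc⟩ : ∃ c : ℝ, c = min b (β * (κ / 4 ^ N) / 4) := ⟨_, rfl⟩
  have hc0 : 0 < c := by rw [hc]; exact lt_min hb (by positivity)
  have hcb : c ≤ b := hc ▸ min_le_left _ _
  have hcκ : c ≤ β * (κ / 4 ^ N) / 4 := hc ▸ min_le_right _ _
  refine ⟨δ / (4 * 6 ^ N), c, by positivity, hc0, by linarith, ?_⟩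
  intro ε s S ρ t u hε hε1 hεs hs1 ht hρ h hS hA
  by_contra! hcon
  obtain ⟨hcon1, hcon2⟩ := hcon
  have hV := volume_unitBall_pos (N := N)
  have hu := h.measurable
  obtain ⟨A, hAdef⟩ : ∃ A : Set 𝔼, A = {y | t ≤ u y} ∩ ball 0 S := ⟨_, rfl⟩
  obtain ⟨F, hFdef⟩ : ∃ F : Set 𝔼, F = {y | c * t ≤ u y} ∩ ball 0 (S + s) := ⟨_, rfl⟩
  have hAm : MeasurableSet A :=
    hAdef ▸ (measurableSet_le measurable_const hu).inter measurableSet_ball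
  have hFm : MeasurableSet F :=
    hFdef ▸ (measurableSet_le measurable_const hu).inter measurableSet_ball
  have hct : c * t ≤ t := mul_le_of_le_one_left ht.le (by linarith)
  have hAF : A ⊆ F := by
    rw [hAdef, hFdef]
    exact Set.inter_subset_inter (fun y (hy : t ≤ u y) => hct.trans hy)
      (ball_subset_ball (by linarith))
  have hAS : A ⊆ ball 0 S := hAdef ▸ Set.inter_subset_right
  have hAt : ∀ y ∈ A, t ≤ u y := fun y hy => by rw [hAdef] at hy; exact hy.1
  have hFS : F ⊆ ball 0 (S + s) := hFdef ▸ Set.inter_subset_right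
  rw [← hAdef] at hA hcon2
  rw [← hFdef] at hcon2
  obtain ⟨Z, hZ⟩ : ∃ Z : Set 𝔼, Z = {x ∈ A | volume.real (A ∩ ball x (ε / 4)) ≤
    κ * volume.real (ball x (ε / 4))} := ⟨_, rfl⟩
  have hball : ∀ x ∈ A, ∀ r ≤ s, ball x r ⊆ ball (0 : 𝔼) (S + s) := fun x hx r hr =>
    ball_subset_ball' (by have := mem_ball.1 (hAS hx); linarith)
  have hmem2 : ∀ x ∈ A, x ∈ ball (0 : 𝔼) 2 := fun x hx => ball_subset_ball (by linarith) (hAS hx)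
  have hrad : ∀ x ∈ A \ Z, ∃ r, 0 < r ∧ r ≤ s ∧ ball x r ⊆ F ∧
      δ * volume.real (ball x r) ≤ volume.real (ball x r \ A) := by
    intro x hx
    have hx2 := hmem2 x hx.1
    have hbase : ∀ y ∈ ball x (ε / 4), c * t ≤ u y := by
      intro y hy
      have hxy : ball x (ε / 4) ⊆ ball y ε :=
        ball_subset_ball' (by have := mem_ball'.1 hy; linarith)
      have h1 : κ * volume.real (ball x (ε / 4)) < volume.real (A ∩ ball x (ε / 4)) := by
        by_contra! h2
        exact hx.2 (by rw [hZ]; exact ⟨hx.1, h2⟩)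
      refine le_trans (mul_le_mul_of_nonneg_right hcκ ht.le)
        (h.le_of_volume_superlevel (θ := κ / 4 ^ N) hα hβ hαβ hε ?_ ht ?_ ?_)
      · refine mem_ball.2 ?_
        have := dist_triangle y x 0
        have := mem_ball.1 hy
        have := mem_ball.1 hx2
        linarith
      · have h2 : ρ * ε ^ 2 ≤ c * t * ε ^ 2 := mul_le_mul_of_nonneg_right hρ (sq_nonneg ε)
        have h3 : c * t * ε ^ 2 ≤ c * t :=
          mul_le_of_le_one_right (by positivity) (pow_le_one₀ hε.le hε1)
        exact (h2.trans h3).trans (mul_le_mul_of_nonneg_right hcκ ht.le)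
      · have h2 : volume.real (A ∩ ball x (ε / 4)) ≤ volume.real (ball y ε ∩ {z | t ≤ u z}) :=
          volume_mono (fun z hz => ⟨hxy hz.2, hAt z hz.1⟩) Set.inter_subset_left
        have h3 : κ / 4 ^ N * volume.real (ball y ε) = κ * volume.real (ball x (ε / 4)) := by
          rw [volume_ball hε, volume_ball (show 0 < ε / 4 by positivity), div_pow]; field_simp
        linarith
    have hstep : ∀ j : ℕ, 1 ≤ j → j * (ε / 4) ≤ s →
        volume.real (ball x (j * (ε / 4)) \ A) ≤ δ * volume.real (ball x (j * (ε / 4))) →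
          ∀ y ∈ ball x ((j + 1) * (ε / 4)), c * t ≤ u y := by
      intro j hj hjs hvol y hy
      have hj' : (1 : ℝ) ≤ j := by exact_mod_cast hj
      refine le_trans (mul_le_mul_of_nonneg_right hcb ht.le)
        (HE ε (j * (ε / 4)) ρ t u x hε hε1 (le_mul_of_one_le_left (by positivity) hj')
        (hjs.trans hs1) ht (hρ.trans (mul_le_mul_of_nonneg_right hcb ht.le))
        (h.mono le_rfl (ball_subset_ball' (by have := mem_ball.1 hx2; linarith))) ?_ y ?_)
      · exact (volume_mono (Set.sdiff_subset_sdiff_right fun z hz => hAt z hz)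
          Set.sdiff_subset).trans hvol
      · convert hy using 2; ring
    classical
    have hex : ∃ j : ℕ, 1 ≤ j ∧ j * (ε / 4) ≤ s ∧
        δ * volume.real (ball x (j * (ε / 4))) < volume.real (ball x (j * (ε / 4)) \ A) := by
      by_contra! hno
      have h4 : 0 < ε / 4 := by positivity
      have hn1 : 1 ≤ ⌊s / (ε / 4)⌋₊ := Nat.le_floor (by
        rw [Nat.cast_one, le_div_iff₀ h4]; linarith)
      have hns : ⌊s / (ε / 4)⌋₊ * (ε / 4) ≤ s := by
        rw [← le_div_iff₀ h4]; exact Nat.floor_le (div_nonneg (by linarith) h4.le)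
      have hns' : s < (⌊s / (ε / 4)⌋₊ + 1) * (ε / 4) := by
        rw [← div_lt_iff₀ h4]; exact Nat.lt_floor_add_one _
      obtain ⟨y, hy, hy2⟩ := hcon1 x hx2
      exact absurd (hstep _ hn1 hns (hno _ hn1 hns) y (ball_subset_ball hns'.le hy)) (not_le.2 hy2)
    obtain ⟨h1, h2, h3⟩ := Nat.find_spec hex
    have hmin : ∀ j < Nat.find hex, _ := fun j hj => Nat.find_min hex hj
    obtain ⟨n, hn⟩ : ∃ n, n = Nat.find hex := ⟨_, rfl⟩
    rw [← hn] at h1 h2 h3 hmin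
    have hn1 : (1 : ℝ) ≤ n := by exact_mod_cast h1
    refine ⟨n * (ε / 4), mul_pos (by linarith) (by positivity), h2, ?_, h3.le⟩
    rw [hFdef]
    refine Set.subset_inter ?_ (hball x hx.1 _ h2)
    obtain ⟨m, rfl⟩ : ∃ m, n = m + 1 := ⟨n - 1, by omega⟩
    intro y hy
    rcases Nat.eq_zero_or_pos m with rfl | hm
    · exact hbase y (by simpa using hy)
    · push_cast at hy h2
      have hms : m * (ε / 4) ≤ s := by linarith
      have := hmin m (by omega)
      push Not at this
      exact hstep m hm hms (this hm hms) y hy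
  have hZ1 : volume.real Z ≤ 1 / 4 * volume.real (ball (0 : 𝔼) 1) := by
    have h1 := volume_low_density_le hκ0.le (show 0 < ε / 4 by positivity) hAS
    rw [← hZ] at h1
    refine h1.trans ?_
    have h2 : volume.real (ball (0 : 𝔼) (S + ε / 4)) ≤ volume.real (ball (0 : 𝔼) 4) :=
      volume_mono (ball_subset_ball (by linarith)) subset_rfl
    refine (mul_le_mul_of_nonneg_left h2 (by positivity)).trans (le_of_eq ?_)
    have h24 : (24 : ℝ) ^ N = 6 ^ N * 4 ^ N := by rw [← mul_pow]; norm_num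
    rw [volume_ball (show (0 : ℝ) < 4 by norm_num), hκ, h24]
    field_simp
  choose! r hr using hrad
  have hZ2 := volume_le_of_deficient hδ hAm hFm hFS (fun x hx => ⟨(hr x hx).1, (hr x hx).2.1⟩)
    (fun x hx => (hr x hx).2.2.1) (fun x hx => (hr x hx).2.2.2)
  have hAZ : volume.real A ≤ volume.real Z + volume.real (A \ Z) := by
    refine volume_le_add (x := 0) (y := 0) (r := S) (r' := S) (fun y hy => ?_) ?_
      (Set.sdiff_subset.trans hAS)
    · by_cases hyZ : y ∈ Z
      · exact Or.inl hyZ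
      · exact Or.inr ⟨hy, hyZ⟩
    · rw [hZ]; exact fun y hy => hAS hy.1
  have hFA : volume.real (F \ A) = volume.real F - volume.real A :=
    measureReal_sdiff hAF hAm (volume_ne_top hFS)
  have h5 : 1 / 4 * volume.real (ball (0 : 𝔼) 1) ≤ 6 ^ N / δ * volume.real (F \ A) := by linarith
  have h6 : δ / (4 * 6 ^ N) * volume.real (ball (0 : 𝔼) 1) ≤ volume.real (F \ A) := by
    calc _ = δ / 6 ^ N * (1 / 4 * volume.real (ball (0 : 𝔼) 1)) := by field_simp
      _ ≤ δ / 6 ^ N * (6 ^ N / δ * volume.real (F \ A)) :=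
        mul_le_mul_of_nonneg_left h5 (by positivity)
      _ = _ := by field_simp
  linarith

/-- A supersolution that is at least one on half of the unit ball is bounded below there. -/
lemma exists_le_of_volume_superlevel (Λ : ℝ) {α β : ℝ} (hα : 0 ≤ α) (hβ : 0 < β)
    (hαβ : α + β = 1) :
    ∃ c ε₁ : ℝ, 0 < c ∧ c < 1 ∧ 0 < ε₁ ∧ ∀ (ε : ℝ) (u : 𝔼 → ℝ), 0 < ε → ε ≤ ε₁ →
      IsSupersol Λ α β ε c u 0 12 →
        1 / 2 * volume.real (ball (0 : 𝔼) 1) ≤ volume.real ({y | 1 ≤ u y} ∩ ball 0 1) →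
          ∀ y ∈ ball (0 : 𝔼) 1, c ≤ u y := by
  obtain ⟨σ, b, hσ, hb, hb1, HI⟩ := exists_volume_superlevel_growth (N := N) Λ hα hβ hαβ
  obtain ⟨a, ε₁, ha, ha1, hε₁, HG⟩ := exists_pow_mul_le_of_le_ball (N := N) Λ hα hβ hαβ
  obtain ⟨m, hm⟩ := exists_nat_gt ((2 : ℝ) ^ N / σ)
  rw [div_lt_iff₀ hσ] at hm
  obtain ⟨p, hp⟩ := pow_unbounded_of_one_lt (3 * m : ℝ) (one_lt_two)
  have hm0 : m ≠ 0 := by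
    rintro rfl
    rw [Nat.cast_zero, zero_mul] at hm
    exact absurd hm (not_lt.2 (by positivity))
  have hm1 : (1 : ℝ) ≤ m := by exact_mod_cast Nat.one_le_iff_ne_zero.2 hm0
  obtain ⟨s, hs⟩ : ∃ s : ℝ, s = 3 / 2 ^ p := ⟨_, rfl⟩
  have hs0 : 0 < s := hs ▸ by positivity
  have hms : m * s ≤ 1 := by
    rw [hs, mul_div_assoc', div_le_one (by positivity)]; linarith
  have hs1 : s ≤ 1 := by nlinarith
  have hbm : 0 < b ^ m := by positivity
  have hap : a ^ p ≤ 1 := pow_le_one₀ ha.le ha1.le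
  have hcm : a ^ p * b ^ m ≤ b ^ m := mul_le_of_le_one_left hbm.le hap
  refine ⟨a ^ p * b ^ m, min (ε₁ / 2 ^ p) s, by positivity,
    hcm.trans_lt (pow_lt_one₀ hb.le hb1 hm0), lt_min (by positivity) hs0, ?_⟩
  intro ε u hε hεm h hhalf
  have hV := volume_unitBall_pos (N := N)
  have hεs : ε ≤ s := hεm.trans (min_le_right _ _)
  have hball : ∃ x ∈ ball (0 : 𝔼) 2, ∀ y ∈ ball x s, b ^ m ≤ u y := by
    by_contra hno
    have key : ∀ k ≤ m, (1 / 2 + k * σ) * volume.real (ball (0 : 𝔼) 1) ≤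
        volume.real ({y | b ^ k ≤ u y} ∩ ball 0 (1 + k * s)) := by
      intro k
      induction k with
      | zero =>
        intro _
        simpa using hhalf
      | succ k ih =>
        intro hk
        have h1 := ih (by omega)
        have hk' : (k + 1 : ℝ) ≤ m := by exact_mod_cast hk
        have hbk : b ^ m ≤ b * b ^ k := by
          rw [← pow_succ']; exact pow_le_pow_of_le_one hb.le hb1.le hk
        have h2 := HI ε s (1 + k * s) _ (b ^ k) u hε (hεs.trans hs1) hεs hs1 (by positivity)
          (hcm.trans hbk) h (by nlinarith) (by
            have : 0 ≤ k * σ * volume.real (ball (0 : 𝔼) 1) := by positivity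
            linarith)
        rcases h2 with ⟨x, hx, hx2⟩ | h2
        · exact absurd ⟨x, hx, fun y hy => hbk.trans (hx2 y hy)⟩ hno
        · rw [← pow_succ'] at h2
          push_cast
          have h3 : 1 + (k + 1) * s = 1 + k * s + s := by ring
          rw [h3]
          linarith
    have h1 := (key m le_rfl).trans (volume_mono Set.inter_subset_right
      (ball_subset_ball (show 1 + m * s ≤ 2 by linarith)))
    have h2 : volume.real (ball (0 : 𝔼) (1 + m * s)) ≤ volume.real (ball (0 : 𝔼) 2) :=
      volume_mono (ball_subset_ball (by linarith)) subset_rfl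
    rw [volume_ball (show (0 : ℝ) < 2 by norm_num)] at h2
    have h3 := mul_lt_mul_of_pos_right hm hV
    linarith
  obtain ⟨x, hx, hxu⟩ := hball
  have hx2 := mem_ball.1 hx
  refine fun y hy => HG p ε _ (b ^ m) u x hε (hεm.trans (min_le_left _ _)) hbm le_rfl
    (h.mono le_rfl (ball_subset_ball' (by linarith))) (hs ▸ hxu) y ?_
  have := dist_triangle_right y x 0
  have := mem_ball.1 hy
  exact mem_ball.2 (by linarith)

/-! ### Oscillation decay -/

/-- A localized and scaled form of `exists_le_of_volume_superlevel`. -/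
lemma exists_le_of_volume_superlevel_local {Λ α β : ℝ} (hΛ : 1 ≤ Λ) (hα : 0 ≤ α) (hβ : 0 < β)
    (hαβ : α + β = 1) :
    ∃ c ε₁ : ℝ, 0 < c ∧ c < 1 ∧ 0 < ε₁ ∧ ∀ (ε r ρ t b : ℝ) (v : 𝔼 → ℝ) (x : 𝔼), 0 < ε → 0 < r →
      ε ≤ ε₁ * r → 0 < t → t * ρ * (r / 16) ^ 2 ≤ c → Measurable v →
      (∀ z ∈ ball x r, SuperAt Λ α β ε ρ v z) → (∀ z ∈ ball x r, 0 ≤ t * v z + b) →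
      (∀ z ∈ ball x r, t * v z + b ≤ 2) →
      1 / 2 * volume.real (ball (0 : 𝔼) 1) ≤
        volume.real ({y | 1 ≤ t * v (x + (r / 16) • y) + b} ∩ ball 0 1) →
      ∀ z ∈ ball x (r / 16), c ≤ t * v z + b := by
  obtain ⟨c, ε₁, hc, hc1, hε₁, H⟩ := exists_le_of_volume_superlevel (N := N) Λ hα hβ hαβ
  have hΛ0 : 0 < Λ := by linarith
  refine ⟨c, min (ε₁ / 16) (1 / (4 * Λ)), hc, hc1, lt_min (by positivity) (by positivity), ?_⟩
  intro ε r ρ t b v x hε hr hεr ht hρ hv hsuper h0 h2 hhalf z hz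
  have hr16 : 0 < r / 16 := by positivity
  have hε1 : ε / (r / 16) ≤ ε₁ := by
    rw [div_le_iff₀ hr16]
    have := mul_le_mul_of_nonneg_right (min_le_left (ε₁ / 16) (1 / (4 * Λ))) hr.le
    linarith
  have hε2 : Λ * (ε / (r / 16)) ≤ 4 := by
    rw [mul_div_assoc', div_le_iff₀ hr16]
    have h1 := hεr.trans (mul_le_mul_of_nonneg_right (min_le_right (ε₁ / 16) (1 / (4 * Λ))) hr.le)
    have h3 := mul_le_mul_of_nonneg_left h1 hΛ0.le
    have h4 : Λ * (1 / (4 * Λ) * r) = r / 4 := by field_simp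
    linarith
  have hmem : ∀ s : ℝ, ∀ y : 𝔼, x + (r / 16) • y ∈ ball x (r / 16 * s) ↔ y ∈ ball (0 : 𝔼) s := by
    intro s y
    have := preimage_ball_rescale (x₀ := x) (x := 0) (s := s) hr16
    rw [smul_zero, add_zero] at this
    rw [← this, Set.mem_preimage]
  have hmem16 : ∀ y ∈ ball (0 : 𝔼) 16, x + (r / 16) • y ∈ ball x r := fun y hy => by
    simpa only [div_mul_cancel₀ r (by norm_num : (16 : ℝ) ≠ 0)] using (hmem 16 y).2 hy
  obtain ⟨w, hw⟩ : ∃ w : 𝔼 → ℝ,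
    w = (ball (0 : 𝔼) 16).indicator fun y => t * v (x + (r / 16) • y) + b := ⟨_, rfl⟩
  have hwin : ∀ y ∈ ball (0 : 𝔼) 16, w y = t * v (x + (r / 16) • y) + b := fun y hy => by
    rw [hw, Set.indicator_of_mem hy]
  have hwout : ∀ y, y ∉ ball (0 : 𝔼) 16 → w y = 0 := fun y hy => by
    rw [hw, Set.indicator_of_notMem hy]
  have hw0 : ∀ y, 0 ≤ w y := fun y => by
    by_cases hy : y ∈ ball (0 : 𝔼) 16
    · rw [hwin y hy]; exact h0 _ (hmem16 y hy)
    · rw [hwout y hy]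
  have hsup : IsSupersol Λ α β (ε / (r / 16)) c w 0 12 := by
    refine ⟨?_, ⟨2, fun y => ?_⟩, hw0, fun y hy => ?_⟩
    · rw [hw]; exact Measurable.indicator (by fun_prop) measurableSet_ball
    · rw [abs_of_nonneg (hw0 y)]
      by_cases hy : y ∈ ball (0 : 𝔼) 16
      · rw [hwin y hy]; exact h2 _ (hmem16 y hy)
      · rw [hwout y hy]; norm_num
    · have hy16 : y ∈ ball (0 : 𝔼) 16 := ball_subset_ball (by norm_num) hy
      refine SuperAt.congr (((hsuper _ (hmem16 y hy16)).rescale hr16 ht b).mono hρ) hΛ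
        (by positivity) fun z hz => (hwin z ?_).symm
      exact ball_subset_ball' (by have := mem_ball.1 hy; linarith) hz
  have hsub : ∀ y ∈ ball (0 : 𝔼) 1, y ∈ ball (0 : 𝔼) 16 :=
    fun y hy => ball_subset_ball (by norm_num) hy
  have hset : {y | 1 ≤ t * v (x + (r / 16) • y) + b} ∩ ball 0 1 =
      {y | 1 ≤ w y} ∩ ball (0 : 𝔼) 1 := by
    ext y
    simp only [Set.mem_inter_iff, Set.mem_ofPred_eq]
    refine and_congr_left fun hy => ?_
    rw [hwin y (hsub y hy)]
  rw [hset] at hhalf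
  have hzr : x + (r / 16) • (r / 16)⁻¹ • (z - x) = z := by
    rw [smul_smul, mul_inv_cancel₀ hr16.ne', one_smul, add_sub_cancel]
  have hz1 : (r / 16)⁻¹ • (z - x) ∈ ball (0 : 𝔼) 1 := (hmem 1 _).1 (by rwa [hzr, mul_one])
  have := H _ w (by positivity) hε1 hsup hhalf _ hz1
  rwa [hwin _ (hsub _ hz1), hzr] at this

lemma exists_oscillation_le {Λ α β : ℝ} (hΛ : 1 ≤ Λ) (hα : 0 ≤ α) (hβ : 0 < β)
    (hαβ : α + β = 1) :
    ∃ c ε₁ : ℝ, 0 < c ∧ c ≤ 1 / 2 ∧ 0 < ε₁ ∧ ∀ (ε r ρ D : ℝ) (u : 𝔼 → ℝ) (x : 𝔼), 0 < ε → 0 < r →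
      ε ≤ ε₁ * r → 0 < D → ρ * r ^ 2 ≤ c * D → Measurable u →
      (∀ z ∈ ball x r, SuperAt Λ α β ε ρ u z) → (∀ z ∈ ball x r, SuperAt Λ α β ε ρ (-u) z) →
      (∀ p ∈ ball x r, ∀ q ∈ ball x r, u p - u q ≤ D) →
      ∀ p ∈ ball x (r / 16), ∀ q ∈ ball x (r / 16), u p - u q ≤ (1 - c) * D := by
  obtain ⟨c, ε₁, hc, hc1, hε₁, H⟩ :=
    exists_le_of_volume_superlevel_local (N := N) hΛ hα hβ hαβ
  refine ⟨c / 2, ε₁, by positivity, by linarith, hε₁, ?_⟩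
  intro ε r ρ D u x hε hr hεr hD hρ hu hsuper hsuper' hosc
  have hxr : x ∈ ball x r := mem_ball_self hr
  obtain ⟨a, ha⟩ : ∃ a : ℝ, a = sInf (u '' ball x r) := ⟨_, rfl⟩
  have hle : ∀ z ∈ ball x r, a ≤ u z := fun z hz => by
    rw [ha]
    refine csInf_le ⟨u x - D, ?_⟩ ⟨z, hz, rfl⟩
    rintro _ ⟨y, hy, rfl⟩
    linarith [hosc x hxr y hy]
  have hge : ∀ z ∈ ball x r, u z ≤ a + D := fun z hz => by
    have : u z - D ≤ a := by
      rw [ha]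
      refine le_csInf ⟨_, x, hxr, rfl⟩ ?_
      rintro _ ⟨y, hy, rfl⟩
      linarith [hosc z hz y hy]
    linarith
  have ht : 0 < 2 / D := by positivity
  have hDt : 2 / D * D = 2 := div_mul_cancel₀ _ hD.ne'
  have hρ' : 2 / D * ρ * (r / 16) ^ 2 ≤ c := by
    have h1 := mul_le_mul_of_nonneg_left hρ ht.le
    have h2 : 2 / D * (c / 2 * D) = c := by field_simp
    calc 2 / D * ρ * (r / 16) ^ 2 = 2 / D * (ρ * r ^ 2) / 256 := by ring
      _ ≤ c := by linarith
  have hV := volume_unitBall_pos (N := N)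
  have hsub : ball x (r / 16) ⊆ ball x r := ball_subset_ball (by linarith)
  have hlow : ∀ z ∈ ball x r, 2 / D * a ≤ 2 / D * u z := fun z hz =>
    mul_le_mul_of_nonneg_left (hle z hz) ht.le
  have hupp : ∀ z ∈ ball x r, 2 / D * u z ≤ 2 / D * a + 2 := fun z hz => by
    have := mul_le_mul_of_nonneg_left (hge z hz) ht.le
    rwa [mul_add, hDt] at this
  have hcover := volume_le_add (x := 0) (y := 0) (r := 1) (r' := 1) (s := ball (0 : 𝔼) 1)
    (A := {y | 1 ≤ 2 / D * u (x + (r / 16) • y) + -(2 / D * a)} ∩ ball 0 1)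
    (B := {y | 1 ≤ 2 / D * (-u) (x + (r / 16) • y) + (2 / D * a + 2)} ∩ ball 0 1)
    (fun y hy => by
      rcases le_total 1 (2 / D * u (x + (r / 16) • y) + -(2 / D * a)) with h | h
      · exact Or.inl ⟨h, hy⟩
      · refine Or.inr ⟨?_, hy⟩
        simp only [Set.mem_ofPred_eq, Pi.neg_apply]
        linarith)
    Set.inter_subset_right Set.inter_subset_right
  have hfin : ∀ p q : 𝔼, 2 / D * (u p - u q) ≤ 2 - c → u p - u q ≤ (1 - c / 2) * D := by
    intro p q h
    rw [div_mul_eq_mul_div, div_le_iff₀ hD] at h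
    linarith
  intro p hp q hq
  refine hfin p q ?_
  rcases le_or_gt (1 / 2 * volume.real (ball (0 : 𝔼) 1))
    (volume.real ({y | 1 ≤ 2 / D * u (x + (r / 16) • y) + -(2 / D * a)} ∩ ball 0 1)) with h | h
  · have h1 := H ε r ρ (2 / D) (-(2 / D * a)) u x hε hr hεr ht hρ' hu hsuper
      (fun z hz => by linarith [hlow z hz]) (fun z hz => by linarith [hupp z hz]) h q hq
    linarith [hupp p (hsub hp)]
  · have h1 := H ε r ρ (2 / D) (2 / D * a + 2) (-u) x hε hr hεr ht hρ' hu.neg hsuper'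
      (fun z hz => by rw [Pi.neg_apply]; linarith [hupp z hz])
      (fun z hz => by rw [Pi.neg_apply]; linarith [hlow z hz]) (by linarith) p hp
    rw [Pi.neg_apply] at h1
    linarith [hlow q (hsub hq)]

lemma exists_oscillation_le_pow {Λ α β : ℝ} (hΛ : 1 ≤ Λ) (hα : 0 ≤ α) (hβ : 0 < β)
    (hαβ : α + β = 1) :
    ∃ c ε₁ : ℝ, 0 < c ∧ c ≤ 1 / 2 ∧ 0 < ε₁ ∧ ∀ (n : ℕ) (ε r ρ D : ℝ) (u : 𝔼 → ℝ) (x : 𝔼),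
      0 < ε → 0 < r → ε ≤ ε₁ * (r / 16 ^ n) → 0 < D → ρ * r ^ 2 ≤ c * D → Measurable u →
      (∀ z ∈ ball x r, SuperAt Λ α β ε ρ u z) → (∀ z ∈ ball x r, SuperAt Λ α β ε ρ (-u) z) →
      (∀ p ∈ ball x r, ∀ q ∈ ball x r, u p - u q ≤ D) →
      ∀ p ∈ ball x (r / 16 ^ n), ∀ q ∈ ball x (r / 16 ^ n), u p - u q ≤ (1 - c) ^ n * D := by
  obtain ⟨c, ε₁, hc, hc1, hε₁, H⟩ := exists_oscillation_le (N := N) hΛ hα hβ hαβ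
  refine ⟨c, ε₁, hc, hc1, hε₁, fun n => ?_⟩
  induction n with
  | zero =>
    intro ε r ρ D u x _ _ _ _ _ _ _ _ hosc
    simpa using hosc
  | succ n ih =>
    intro ε r ρ D u x hε hr hεr hD hρ hu hsuper hsuper' hosc
    have h16 : r / 16 ^ (n + 1) = r / 16 / 16 ^ n := by rw [pow_succ']; field_simp
    have hsub : ball x (r / 16) ⊆ ball x r := ball_subset_ball (by linarith)
    have h1 : r / 16 / 16 ^ n ≤ r := by
      refine (div_le_self (by positivity) (one_le_pow₀ (by norm_num))).trans (by linarith)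
    rw [h16] at hεr
    have hεr' : ε ≤ ε₁ * r := hεr.trans (mul_le_mul_of_nonneg_left h1 hε₁.le)
    rw [h16, pow_succ, mul_assoc]
    refine ih ε (r / 16) ρ ((1 - c) * D) u x hε (by positivity) hεr
      (mul_pos (by linarith) hD) ?_ hu (fun z hz => hsuper z (hsub hz))
      (fun z hz => hsuper' z (hsub hz))
      (H ε r ρ D u x hε hr hεr' hD hρ hu hsuper hsuper' hosc)
    have h2 : c * (1 / 2 * D) ≤ c * ((1 - c) * D) :=
      mul_le_mul_of_nonneg_left (mul_le_mul_of_nonneg_right (by linarith) hD.le) hc.le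
    have h3 : 0 < c * D := by positivity
    calc ρ * (r / 16) ^ 2 = ρ * r ^ 2 / 256 := by ring
      _ ≤ _ := by linarith

/-! ### The extremal operators -/

lemma superAt_of_Lminus_le (hΛ : 1 ≤ Λ) (hα : 0 ≤ α) (hε : 0 < ε)
    (h : Lminus Λ α β ε u x ≤ ρ) : SuperAt Λ α β ε ρ u x := by
  intro m hm
  rw [Lminus, one_div, inv_mul_le_iff₀ (by positivity)] at h
  have h1 : m ≤ sInf ((fun z => ddiff u x (ε • z)) '' ball (0 : 𝔼) Λ) := by
    refine le_csInf ((nonempty_ball.2 (by linarith)).image _) ?_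
    rintro _ ⟨z, hz, rfl⟩
    exact hm z hz
  linarith [mul_le_mul_of_nonneg_left h1 hα]

lemma superAt_neg_of_le_Lplus (hΛ : 1 ≤ Λ) (hα : 0 ≤ α) (hε : 0 < ε)
    (h : -ρ ≤ Lplus Λ α β ε u x) : SuperAt Λ α β ε ρ (-u) x := by
  intro m hm
  have hneg : ∀ z, ddiff (-u) x z = -ddiff u x z := fun z => by
    simp only [ddiff, Pi.neg_apply]; ring
  simp only [hneg] at hm ⊢
  rw [average_neg]
  rw [Lplus, one_div, le_inv_mul_iff₀ (by positivity)] at h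
  have h1 : sSup ((fun z => ddiff u x (ε • z)) '' ball (0 : 𝔼) Λ) ≤ -m := by
    refine csSup_le ((nonempty_ball.2 (by linarith)).image _) ?_
    rintro _ ⟨z, hz, rfl⟩
    linarith [hm z hz]
  linarith [mul_le_mul_of_nonneg_left h1 hα]

/-! ### The Harnack estimate -/

lemma exists_harnack {Λ α β : ℝ} (hΛ : 1 ≤ Λ) (hα : 0 ≤ α) (hβ : 0 < β) (hαβ : α + β = 1) :
    ∃ C l ε₀ : ℝ, 0 < C ∧ 0 < l ∧ 0 < ε₀ ∧ ∀ (ε ρ D : ℝ) (u : 𝔼 → ℝ), 0 < ε → ε ≤ ε₀ →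
      Measurable u → (∃ K, ∀ x, |u x| ≤ K) → (∀ x, 0 ≤ u x) →
      (∀ x ∈ ball (0 : 𝔼) 7, SuperAt Λ α β ε ρ u x) →
      (∀ x ∈ ball (0 : 𝔼) 7, SuperAt Λ α β ε ρ (-u) x) → 0 < D → ρ ≤ D →
      (∃ q ∈ ball (0 : 𝔼) 1, u q < D) → (∀ y ∈ ball (0 : 𝔼) 3, ε ^ (2 * l) * u y < D) →
      ∀ p ∈ ball (0 : 𝔼) 1, u p ≤ C * D := by
  obtain ⟨g, εG, hg, hg1, hεG, HG⟩ := exists_pow_mul_le_of_le_ball (N := N) Λ hα hβ hαβ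
  obtain ⟨c, εO, hc, hc1, hεO, HO⟩ := exists_oscillation_le_pow (N := N) hΛ hα hβ hαβ
  obtain ⟨n₀, hn₀⟩ := exists_pow_lt_of_lt_one (show 0 < g / 2 by positivity)
    (show 1 - c < 1 by linarith)
  obtain ⟨k₀, hk₀⟩ : ∃ k₀, k₀ = 4 * n₀ + 3 := ⟨_, rfl⟩
  obtain ⟨ε₁, hε₁⟩ : ∃ ε₁ : ℝ, ε₁ = min εG εO := ⟨_, rfl⟩
  have hε₁0 : 0 < ε₁ := hε₁ ▸ lt_min hεG hεO
  have hε₁G : ε₁ ≤ εG := hε₁ ▸ min_le_left _ _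
  have hε₁O : ε₁ ≤ εO := hε₁ ▸ min_le_right _ _
  obtain ⟨l, hl⟩ : ∃ l : ℝ, l = -Real.logb 2 g / 2 := ⟨_, rfl⟩
  have hl0 : 0 < l := by
    have := Real.logb_neg (b := 2) (by norm_num) hg hg1
    rw [hl]; linarith
  have hgl : (2 : ℝ) ^ (2 * l) = g⁻¹ := by
    rw [hl, mul_div_cancel₀ _ (two_ne_zero), Real.rpow_neg (by norm_num),
      Real.rpow_logb (by norm_num) (by norm_num) hg]
  obtain ⟨G, hG⟩ : ∃ G : ℝ, G = g⁻¹ := ⟨_, rfl⟩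
  have hG0 : 0 < G := hG ▸ inv_pos.2 hg
  have hG1 : 1 ≤ G := hG ▸ (one_le_inv₀ hg).2 hg1.le
  have hgG : g * G = 1 := hG ▸ mul_inv_cancel₀ hg.ne'
  have hgGn : ∀ n : ℕ, g ^ n * G ^ n = 1 := fun n => by rw [← mul_pow, hgG, one_pow]
  rw [← hG] at hgl
  obtain ⟨B, hB⟩ : ∃ B : ℝ, B = 2 * G ^ k₀ + 1 / c + G ^ k₀ / ε₁ ^ (2 * l) := ⟨_, rfl⟩
  have hε₁l : 0 < ε₁ ^ (2 * l) := Real.rpow_pos_of_pos hε₁0 _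
  have hp1 : 0 < 2 * G ^ k₀ := by positivity
  have hp2 : 0 < 1 / c := by positivity
  have hp3 : 0 < G ^ k₀ / ε₁ ^ (2 * l) := by positivity
  have hB0 : 0 < B := by linarith
  refine ⟨B, l, ε₁ / 2 ^ k₀, hB0, hl0, by positivity, ?_⟩
  intro ε ρ D u hε hεε₀ hu hbdd hu0 hsuper hsuper' hD hρ hq hsup p hp
  obtain ⟨q, hq, hqD⟩ := hq
  by_contra! hpB
  rw [le_div_iff₀ (by positivity)] at hεε₀
  have hsmall : ∀ n : ℕ, ε ≤ ε₁ / 2 ^ n → ∀ z ∈ ball (0 : 𝔼) 2,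
      ∃ y ∈ ball z (3 / 2 ^ n), u y < G ^ n * D := by
    intro n hn z hz
    by_contra! hno
    have hz2 := mem_ball.1 hz
    have hgD : g ^ n * (G ^ n * D) = D := by rw [← mul_assoc, hgGn, one_mul]
    have h1 := HG n ε ρ (G ^ n * D) u z hε
      (hn.trans (div_le_div_of_nonneg_right hε₁G (by positivity))) (by positivity)
      (hρ.trans hgD.ge) ⟨hu, hbdd, hu0, fun y hy =>
        hsuper y (ball_subset_ball' (by linarith) hy)⟩ hno q (by
          have := dist_triangle_right q z 0
          have := mem_ball.1 hq
          exact mem_ball.2 (by linarith))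
    rw [hgD] at h1
    linarith
  have hchain : ∀ k : ℕ, ε * 2 ^ (k + k₀) ≤ 2 * ε₁ →
      ∃ x : 𝔼, ‖x‖ < 7 / 4 - 3 / 4 / 2 ^ k ∧ B * G ^ k * D < u x := by
    intro k
    induction k with
    | zero =>
      intro _
      refine ⟨p, ?_, by simpa using hpB⟩
      have := mem_ball_zero_iff.1 hp
      norm_num
      exact this
    | succ k ih =>
      intro hk
      have hεk : ε * 2 ^ (k + k₀) ≤ ε₁ := by
        rw [show k + 1 + k₀ = k + k₀ + 1 by ring, pow_succ] at hk
        linarith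
      obtain ⟨x, hx, hxu⟩ := ih (by linarith)
      have h2k : (0 : ℝ) < 2 ^ k := by positivity
      have h2k1 : (1 : ℝ) ≤ 2 ^ k := one_le_pow₀ (by norm_num)
      obtain ⟨r, hr⟩ : ∃ r : ℝ, r = 3 / 8 / 2 ^ k := ⟨_, rfl⟩
      have hr0 : 0 < r := hr ▸ by positivity
      have hr1 : r ≤ 3 / 8 := hr ▸ div_le_self (by norm_num) h2k1
      have hrn : r / 16 ^ n₀ = 3 / 2 ^ (k + k₀) := by
        have : (2 : ℝ) ^ (k + k₀) = 2 ^ k * (16 ^ n₀ * 8) := by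
          rw [hk₀, pow_add, pow_add, pow_mul]; norm_num
        rw [this, hr]; field_simp
      have hx2 : ‖x‖ < 7 / 4 := by
        have : (0 : ℝ) < 3 / 4 / 2 ^ k := by positivity
        linarith
      by_contra! hno
      have hupper : ∀ y ∈ ball x r, u y ≤ B * G ^ (k + 1) * D := by
        intro y hy
        refine hno y ?_
        have h1 := mem_ball.1 hy
        rw [dist_eq_norm] at h1
        have h2 : ‖y‖ ≤ ‖y - x‖ + ‖x‖ := by
          simpa using norm_add_le (y - x) x
        have h3 : (3 : ℝ) / 4 / 2 ^ (k + 1) = r := by rw [hr, pow_succ]; field_simp; norm_num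
        have h4 : (3 : ℝ) / 4 / 2 ^ k = 2 * r := by rw [hr]; field_simp; norm_num
        linarith
      have hball7 : ball x r ⊆ ball (0 : 𝔼) 7 :=
        ball_subset_ball' (by rw [dist_zero_right]; linarith)
      have hεk' : ε ≤ ε₁ / 2 ^ (k + k₀) := by rwa [le_div_iff₀ (by positivity)]
      obtain ⟨y, hy, hyu⟩ := hsmall (k + k₀) hεk' x (mem_ball_zero_iff.2 (by linarith))
      have hGk : 1 ≤ G ^ (k + 1) := one_le_pow₀ hG1
      have hosc := HO n₀ ε r ρ (B * G ^ (k + 1) * D) u x hε hr0 (by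
          rw [hrn]
          calc ε ≤ ε₁ / 2 ^ (k + k₀) := hεk'
            _ ≤ εO / 2 ^ (k + k₀) := div_le_div_of_nonneg_right hε₁O (by positivity)
            _ = εO * (1 / 2 ^ (k + k₀)) := by ring
            _ ≤ εO * (3 / 2 ^ (k + k₀)) := by gcongr; norm_num) (by positivity) (by
          have h1 : 1 ≤ c * B := by
            rw [← div_le_iff₀' hc]; linarith
          have h2 : 1 ≤ c * B * G ^ (k + 1) := one_le_mul_of_one_le_of_one_le h1 hGk
          calc ρ * r ^ 2 ≤ D * r ^ 2 := mul_le_mul_of_nonneg_right hρ (sq_nonneg r)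
            _ ≤ D := mul_le_of_le_one_right hD.le (pow_le_one₀ hr0.le (by linarith))
            _ ≤ c * B * G ^ (k + 1) * D := le_mul_of_one_le_left hD.le h2
            _ = _ := by ring) hu (fun z hz => hsuper z (hball7 hz))
        (fun z hz => hsuper' z (hball7 hz))
        (fun z hz w _ => by linarith [hupper z hz, hu0 w]) x (mem_ball_self (by positivity)) y
        (by rwa [hrn])
      have h1 : (1 - c) ^ n₀ * (B * G ^ (k + 1) * D) ≤ 1 / 2 * (B * G ^ k * D) := by
        calc _ ≤ g / 2 * (B * G ^ (k + 1) * D) :=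
              mul_le_mul_of_nonneg_right hn₀.le (by positivity)
          _ = g * G * (1 / 2 * (B * G ^ k * D)) := by ring
          _ = _ := by rw [hgG, one_mul]
      have h2 : G ^ (k + k₀) * D ≤ 1 / 2 * (B * G ^ k * D) := by
        have h3 : 2 * G ^ k₀ ≤ B := by linarith
        have h4 : 0 ≤ G ^ k * D := by positivity
        calc _ = 1 / 2 * (2 * G ^ k₀ * (G ^ k * D)) := by ring
          _ ≤ 1 / 2 * (B * (G ^ k * D)) := by gcongr
          _ = _ := by ring
      linarith
  obtain ⟨k, hk1, hk2⟩ := exists_nat_pow_near (x := 2 * ε₁ / (ε * 2 ^ k₀)) (y := 2)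
    (by rw [le_div_iff₀ (by positivity)]; linarith) one_lt_two
  rw [le_div_iff₀ (by positivity)] at hk1
  rw [div_lt_iff₀ (by positivity)] at hk2
  have hk3 : ε₁ < ε * (2 ^ k * 2 ^ k₀) := by rw [pow_succ] at hk2; linarith
  obtain ⟨x, hx, hxu⟩ := hchain k (by rw [pow_add]; linarith)
  have hx3 : x ∈ ball (0 : 𝔼) 3 := by
    have : (0 : ℝ) < 3 / 4 / 2 ^ k := by positivity
    exact mem_ball_zero_iff.2 (by linarith)
  have h1 := hsup x hx3
  have hεl : 0 < ε ^ (2 * l) := Real.rpow_pos_of_pos hε _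
  have h2 : ε₁ ^ (2 * l) ≤ ε ^ (2 * l) * (G ^ k * G ^ k₀) := by
    have h3 := Real.rpow_le_rpow hε₁0.le hk3.le (show 0 ≤ 2 * l by linarith)
    have h4 : ∀ n : ℕ, ((2 : ℝ) ^ n) ^ (2 * l) = G ^ n := fun n => by
      rw [← hgl, ← Real.rpow_natCast, ← Real.rpow_mul (by norm_num), mul_comm,
        Real.rpow_mul (by norm_num), Real.rpow_natCast]
    rwa [Real.mul_rpow hε.le (by positivity), Real.mul_rpow (by positivity) (by positivity),
      h4, h4] at h3
  have h5 : G ^ k₀ / ε₁ ^ (2 * l) ≤ B := by linarith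
  rw [div_le_iff₀ hε₁l] at h5
  have h6 : 1 ≤ ε ^ (2 * l) * (B * G ^ k) := by
    have h7 := mul_le_mul_of_nonneg_left h2 hB0.le
    have h8 : 0 < G ^ k₀ := by positivity
    refine le_of_mul_le_mul_right ?_ h8
    linarith
  have h9 := mul_le_mul_of_nonneg_left hxu.le hεl.le
  have h10 := mul_le_mul_of_nonneg_right h6 hD.le
  linarith

end AsymptoticHarnack

/-- **asymptotic Harnack's inequality.** There exist `C > 0`, `λ > 0` and
`ε₀ > 0`, depending only on `N, Λ, α, β`, such that if `ρ ≥ 0` and `u ≥ 0` is bounded Borel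
measurable with `L_ε^+ u ≥ −ρ` and `L_ε^- u ≤ ρ` in `B_7` for some `0 < ε < ε₀`, then
`sup_{B_1} u ≤ C (inf_{B_1} u + ρ + ε^{2λ} sup_{B_3} u)`. -/
theorem asymptotic_harnack (N : ℕ) (hN : 1 ≤ N) (Λ α β : ℝ) (hΛ : 1 ≤ Λ)
    (hβ : β ∈ Set.Ioc (0 : ℝ) 1) (hα : α = 1 - β) :
    ∃ (C lam ε₀ : ℝ), 0 < C ∧ 0 < lam ∧ 0 < ε₀ ∧
      ∀ ρ : ℝ, 0 ≤ ρ → ∀ ε : ℝ, 0 < ε → ε < ε₀ →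
        ∀ u : EuclideanSpace ℝ (Fin N) → ℝ,
          Measurable u → (∃ K, ∀ x, |u x| ≤ K) →
          (∀ x, 0 ≤ u x) →
          (∀ x ∈ ball (0 : EuclideanSpace ℝ (Fin N)) 7,
            -ρ ≤ Lplus Λ α β ε u x ∧ Lminus Λ α β ε u x ≤ ρ) →
          sSup (u '' ball (0 : EuclideanSpace ℝ (Fin N)) 1) ≤
            C * (sInf (u '' ball (0 : EuclideanSpace ℝ (Fin N)) 1) + ρ +
              ε ^ (2 * lam) * sSup (u '' ball (0 : EuclideanSpace ℝ (Fin N)) 3)) := by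
  obtain ⟨hβ0, hβ1⟩ := hβ
  have hα0 : 0 ≤ α := by linarith
  obtain ⟨C, l, ε₀, hC, hl, hε₀, H⟩ := AsymptoticHarnack.exists_harnack (N := N) hΛ hα0 hβ0
    (show α + β = 1 by linarith)
  refine ⟨C, l, ε₀, hC, hl, hε₀, ?_⟩
  intro ρ hρ ε hε hεε₀ u hu hbdd hu0 hL
  have hne : ∀ r : ℝ, 0 < r → (u '' ball (0 : EuclideanSpace ℝ (Fin N)) r).Nonempty :=
    fun r hr => (nonempty_ball.2 hr).image u
  have hinf : 0 ≤ sInf (u '' ball (0 : EuclideanSpace ℝ (Fin N)) 1) :=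
    Real.sInf_nonneg (by rintro _ ⟨y, -, rfl⟩; exact hu0 y)
  have hsup : 0 ≤ sSup (u '' ball (0 : EuclideanSpace ℝ (Fin N)) 3) :=
    Real.sSup_nonneg (by rintro _ ⟨y, -, rfl⟩; exact hu0 y)
  have hεl : 0 < ε ^ (2 * l) := Real.rpow_pos_of_pos hε _
  have hle : ∀ y ∈ ball (0 : EuclideanSpace ℝ (Fin N)) 3,
      u y ≤ sSup (u '' ball (0 : EuclideanSpace ℝ (Fin N)) 3) := fun y hy => by
    obtain ⟨K, hK⟩ := hbdd
    refine le_csSup ⟨K, ?_⟩ ⟨y, hy, rfl⟩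
    rintro _ ⟨z, -, rfl⟩
    exact (le_abs_self _).trans (hK z)
  have hεsup := mul_nonneg hεl.le hsup
  refine le_of_forall_pos_le_add fun η hη => csSup_le (hne 1 one_pos) ?_
  rintro _ ⟨p, hp, rfl⟩
  have hηC : 0 < η / C := by positivity
  obtain ⟨_, ⟨q, hq, rfl⟩, hqη⟩ := exists_lt_of_csInf_lt (hne 1 one_pos)
    (lt_add_of_pos_right (sInf (u '' ball (0 : EuclideanSpace ℝ (Fin N)) 1)) hηC)
  have key := H ε ρ (sInf (u '' ball (0 : EuclideanSpace ℝ (Fin N)) 1) + ρ +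
      ε ^ (2 * l) * sSup (u '' ball (0 : EuclideanSpace ℝ (Fin N)) 3) + η / C) u hε hεε₀.le hu
    hbdd hu0 (fun x hx => AsymptoticHarnack.superAt_of_Lminus_le hΛ hα0 hε (hL x hx).2)
    (fun x hx => AsymptoticHarnack.superAt_neg_of_le_Lplus hΛ hα0 hε (hL x hx).1) (by linarith)
    (by linarith) ⟨q, hq, by linarith⟩
    (fun y hy => by linarith [mul_le_mul_of_nonneg_left (hle y hy) hεl.le]) p hp
  rwa [mul_add, mul_div_cancel₀ η hC.ne'] at key
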